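/- For positive reals a, c with b := 1/2 − a − c > 0 and every real x, one has ψ̃′_{a,c}(x) = e^{−iπ/12} · ψ_{c,b}(x), where ψ_{c,b} denotes the function ψ with parameter pair (c, b). -/

import Mathlib

open Real MeasureTheory

noncomputable section

/-- `c_𝖻 = i(𝖻 + 𝖻⁻¹)/2`. -/
def cB (bb : ℝ) : ℂ := Complex.I * (bb + bb⁻¹) / 2

/-- The integrand in the definition of Faddeev's quantum dilogarithm. -/
def phiKer (bb : ℝ) (z w : ℂ) : ℂ :=
  Complex.exp (-2 * Complex.I * z * w) /
    (4 * Complex.sinh (w * bb) * Complex.sinh (w / bb) * w)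

/-- Faddeev's quantum dilogarithm on the strip `|Im z| < Im c_𝖻`, defined by the
contour integral over `ℝ + iε` with `ε = π·min(𝖻,𝖻⁻¹)/2`. -/
def PhiS (bb : ℝ) (z : ℂ) : ℂ :=
  Complex.exp (∫ t : ℝ, phiKer bb z (t + Complex.I * (π * min bb bb⁻¹ / 2)))

/-- The factor appearing in the functional equation:
`Φ_𝖻(z) = Efac 𝖻 z · Φ_𝖻(z + i𝖻)`. -/
def Efac (bb : ℝ) (z : ℂ) : ℂ := 1 + Complex.exp (2 * π * bb * (z + Complex.I * bb / 2))

/-- Number of upward shifts by `i𝖻` needed to bring `z` into the strip. -/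
def nUp (bb : ℝ) (z : ℂ) : ℕ := ⌊(-((bb + bb⁻¹) / 2) - z.im) / bb⌋₊ + 1

/-- Number of downward shifts by `i𝖻` needed to bring `z` into the strip. -/
def nDn (bb : ℝ) (z : ℂ) : ℕ := ⌊(z.im - (bb + bb⁻¹) / 2) / bb⌋₊ + 1

/-- Faddeev's quantum dilogarithm `Φ_𝖻`, extended from the strip `|Im z| < Im c_𝖻`
to all of `ℂ` as a meromorphic function by the functional equation
`Φ_𝖻(z - i𝖻/2) = (1 + e^{2π𝖻z}) Φ_𝖻(z + i𝖻/2)`. -/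
def Phi (bb : ℝ) (z : ℂ) : ℂ :=
  if z.im ≤ -((bb + bb⁻¹) / 2) then
    (∏ k ∈ Finset.range (nUp bb z), Efac bb (z + Complex.I * k * bb)) *
      PhiS bb (z + Complex.I * (nUp bb z) * bb)
  else if (bb + bb⁻¹) / 2 ≤ z.im then
    PhiS bb (z - Complex.I * (nDn bb z) * bb) /
      ∏ k ∈ Finset.range (nDn bb z), Efac bb (z - Complex.I * (k + 1) * bb)
  else PhiS bb z

/-- `ψ_{a,c}(t) = Φ_𝖻(t - 2c_𝖻(a+c))⁻¹ e^{-4πi c_𝖻 a (t - c_𝖻(a+c))} e^{-πi c_𝖻²(4(a-c)+1)/6}`. -/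
def psiF (bb a c : ℝ) (t : ℂ) : ℂ :=
  (Phi bb (t - 2 * cB bb * (a + c)))⁻¹ *
    Complex.exp (-4 * π * Complex.I * cB bb * a * (t - cB bb * (a + c))) *
    Complex.exp (-π * Complex.I * (cB bb) ^ 2 * (4 * (a - c) + 1) / 6)

/-- `ψ̄_{a,c}(t) = Φ_𝖻(t + 2c_𝖻(a+c)) e^{-4πi c_𝖻 a (t + c_𝖻(a+c))} e^{πi c_𝖻²(4(a-c)+1)/6}`. -/
def psiBar (bb a c : ℝ) (t : ℂ) : ℂ :=
  Phi bb (t + 2 * cB bb * (a + c)) *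
    Complex.exp (-4 * π * Complex.I * cB bb * a * (t + cB bb * (a + c))) *
    Complex.exp (π * Complex.I * (cB bb) ^ 2 * (4 * (a - c) + 1) / 6)

/-- `ψ̃_{a,c}(s) = ∫_ℝ ψ_{a,c}(t) e^{-2πi s t} dt`. -/
def psiT (bb a c : ℝ) (s : ℝ) : ℂ :=
  ∫ t : ℝ, psiF bb a c t * Complex.exp (-2 * π * Complex.I * s * t)

/-- `ψ̃′_{a,c}(s) = e^{-πi s²} ψ̃_{a,c}(s)`. -/
def psiT' (bb a c : ℝ) (s : ℝ) : ℂ :=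
  Complex.exp (-π * Complex.I * s ^ 2) * psiT bb a c s

/-- `g_{a,c}(s,t) = Σ_{m∈ℤ} ψ̃′_{a,c}(s+m) e^{iπ t (s+2m)}`. -/
def gW (bb a c : ℝ) (s t : ℝ) : ℂ :=
  ∑' m : ℤ, psiT' bb a c (s + m) * Complex.exp (Complex.I * π * t * (s + 2 * m))

namespace QuantumDilog

open Filter Topology Set

section

/-- `κ` is continuous and bounded by `C * min (exp (-α t)) (exp (β t))`. -/
structure ExpBound (κ : ℝ → ℂ) (C α β : ℝ) : Prop where
  cont : Continuous κ
  right : ∀ t, ‖κ t‖ ≤ C * Real.exp (-(α * t))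
  left : ∀ t, ‖κ t‖ ≤ C * Real.exp (β * t)

namespace ExpBound

variable {κ : ℝ → ℂ} {C α β : ℝ}

lemma nonneg (h : ExpBound κ C α β) : 0 ≤ C := by
  have := (norm_nonneg _).trans (h.right 0)
  simpa using this

lemma mul_exp (h : ExpBound κ C α β) (s : ℂ) :
    ExpBound (fun t => κ t * Complex.exp (s * t)) C (α - s.re) (β + s.re) := by
  refine ⟨h.cont.mul (by fun_prop), fun t => ?_, fun t => ?_⟩
  · rw [norm_mul, Complex.norm_exp]
    have := mul_le_mul_of_nonneg_right (h.right t) (Real.exp_pos ((s * t).re)).le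
    refine this.trans (le_of_eq ?_)
    rw [mul_assoc, ← Real.exp_add]; congr 2; simp; ring
  · rw [norm_mul, Complex.norm_exp]
    have := mul_le_mul_of_nonneg_right (h.left t) (Real.exp_pos ((s * t).re)).le
    refine this.trans (le_of_eq ?_)
    rw [mul_assoc, ← Real.exp_add]; congr 2; simp; ring

lemma integrableOn_right (h : ExpBound κ C α β) (hα : 0 < α) : IntegrableOn κ (Ioi 0) := by
  refine Integrable.mono' (g := fun t => C * Real.exp (-α * t))
    ((exp_neg_integrableOn_Ioi 0 hα).const_mul C) h.cont.aestronglyMeasurable ?_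
  exact Eventually.of_forall fun t => by simpa using h.right t

lemma integrableOn_left (h : ExpBound κ C α β) (hβ : 0 < β) : IntegrableOn κ (Iic 0) := by
  refine Integrable.mono' (g := fun t => C * Real.exp (β * t))
    ((integrableOn_exp_mul_Iic hβ 0).const_mul C) h.cont.aestronglyMeasurable ?_
  exact Eventually.of_forall fun t => h.left t

lemma integrable (h : ExpBound κ C α β) (hα : 0 < α) (hβ : 0 < β) : Integrable κ := by
  rw [← integrableOn_univ, ← Iic_union_Ioi (a := (0 : ℝ))]
  exact (h.integrableOn_left hβ).union (h.integrableOn_right hα)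

lemma norm_integral_le (h : ExpBound κ C α β) (hα : 0 < α) (hβ : 0 < β) :
    ‖∫ t, κ t‖ ≤ C * (1 / α + 1 / β) := by
  rw [← intervalIntegral.integral_Iic_add_Ioi (b := 0) (h.integrableOn_left hβ)
    (h.integrableOn_right hα)]
  have h1 : ‖∫ t in Iic (0 : ℝ), κ t‖ ≤ ∫ t in Iic (0 : ℝ), C * Real.exp (β * t) :=
    norm_integral_le_of_norm_le ((integrableOn_exp_mul_Iic hβ 0).const_mul C)
      (Eventually.of_forall fun t => h.left t)
  have h2 : ‖∫ t in Ioi (0 : ℝ), κ t‖ ≤ ∫ t in Ioi (0 : ℝ), C * Real.exp (-α * t) :=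
    norm_integral_le_of_norm_le ((exp_neg_integrableOn_Ioi 0 hα).const_mul C)
      (Eventually.of_forall fun t => by simpa using h.right t)
  rw [integral_const_mul, integral_exp_mul_Iic hβ] at h1
  rw [integral_const_mul, integral_exp_mul_Ioi (by linarith : -α < 0)] at h2
  refine (norm_add_le _ _).trans ((add_le_add h1 h2).trans (le_of_eq ?_))
  simp; ring

lemma linear_mul (h : ExpBound κ C α β) {η : ℝ} (hη : 0 < η) (hs : 2 * η ≤ α + β) (p q : ℂ) :
    ExpBound (fun t => (p * t + q) * κ t) ((‖p‖ / η + ‖q‖) * C) (α - η) (β - η) := by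
  have hC := h.nonneg
  have key : ∀ t : ℝ, ‖p * t + q‖ ≤ (‖p‖ / η + ‖q‖) * Real.exp (η * |t|) := by
    intro t
    have h1 : η * |t| + 1 ≤ Real.exp (η * |t|) := Real.add_one_le_exp _
    have h0 : 0 ≤ η * |t| := by positivity
    have h2 : ‖p * t + q‖ ≤ ‖p‖ * |t| + ‖q‖ := by
      refine (norm_add_le _ _).trans ?_
      simp
    have h3 : ‖p‖ * |t| = ‖p‖ / η * (η * |t|) := by field_simp
    have h4 : ‖p‖ / η * (η * |t|) ≤ ‖p‖ / η * Real.exp (η * |t|) :=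
      mul_le_mul_of_nonneg_left (by linarith) (by positivity)
    have h5 : ‖q‖ ≤ ‖q‖ * Real.exp (η * |t|) :=
      le_mul_of_one_le_right (norm_nonneg _) (by linarith)
    rw [add_mul]; linarith
  have comb : ∀ t x y : ℝ, ‖κ t‖ ≤ C * Real.exp x → η * |t| + x ≤ y →
      ‖(p * t + q) * κ t‖ ≤ (‖p‖ / η + ‖q‖) * C * Real.exp y := by
    intro t x y h1 h2
    rw [norm_mul]
    calc _ ≤ ((‖p‖ / η + ‖q‖) * Real.exp (η * |t|)) * (C * Real.exp x) :=
          mul_le_mul (key t) h1 (norm_nonneg _) (by positivity)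
      _ = (‖p‖ / η + ‖q‖) * C * Real.exp (η * |t| + x) := by rw [Real.exp_add]; ring
      _ ≤ _ := mul_le_mul_of_nonneg_left (Real.exp_le_exp.2 h2) (by positivity)
  refine ⟨by have := h.cont; fun_prop, fun t => ?_, fun t => ?_⟩
  · rcases le_total 0 t with ht | ht
    · exact comb t _ _ (h.right t) (by rw [abs_of_nonneg ht]; nlinarith)
    · exact comb t _ _ (h.left t) (by rw [abs_of_nonpos ht]; nlinarith)
  · rcases le_total 0 t with ht | ht
    · exact comb t _ _ (h.right t) (by rw [abs_of_nonneg ht]; nlinarith)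
    · exact comb t _ _ (h.left t) (by rw [abs_of_nonpos ht]; nlinarith)

lemma hasDerivAt_laplace (h : ExpBound κ C α β) {s : ℂ} (h1 : s.re < α) (h2 : -β < s.re) :
    HasDerivAt (fun s : ℂ => ∫ t : ℝ, κ t * Complex.exp (s * t))
      (∫ t : ℝ, t * κ t * Complex.exp (s * t)) s := by
  set r : ℝ := min (α - s.re) (β + s.re) / 4 with hr
  have hm : 0 < min (α - s.re) (β + s.re) := lt_min (by linarith) (by linarith)
  have hrpos : 0 < r := by positivity
  have hr1 : 4 * r ≤ α - s.re := by rw [hr]; have := min_le_left (α - s.re) (β + s.re); linarith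
  have hr2 : 4 * r ≤ β + s.re := by rw [hr]; have := min_le_right (α - s.re) (β + s.re); linarith
  have hs := (h.mul_exp s).linear_mul hrpos (by linarith) 1 0
  have hp := (hs.mul_exp r).integrable (by simp; linarith) (by simp; linarith)
  have hq := (hs.mul_exp (-r)).integrable (by simp; linarith) (by simp; linarith)
  refine (hasDerivAt_integral_of_dominated_loc_of_deriv_le (Metric.ball_mem_nhds s hrpos)
    (F := fun (s : ℂ) (t : ℝ) => κ t * Complex.exp (s * t))
    (F' := fun (s : ℂ) (t : ℝ) => t * κ t * Complex.exp (s * t))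
    (bound := fun t : ℝ => ‖(1 * (t : ℂ) + 0) * (κ t * Complex.exp (s * t)) * Complex.exp (r * t)‖ +
      ‖(1 * (t : ℂ) + 0) * (κ t * Complex.exp (s * t)) * Complex.exp (-r * t)‖)
    ?_ ?_ ?_ ?_ ?_ ?_).2
  · exact Eventually.of_forall fun x => (by have := h.cont; fun_prop :
      Continuous fun t : ℝ => κ t * Complex.exp (x * t)).aestronglyMeasurable
  · exact (h.mul_exp s).integrable (by linarith) (by linarith)
  · exact (by have := h.cont; fun_prop :
      Continuous fun t : ℝ => t * κ t * Complex.exp (s * t)).aestronglyMeasurable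
  · refine Eventually.of_forall fun t x hx => ?_
    simp only [norm_mul, one_mul, add_zero, Complex.norm_exp]
    have e1 : (x * t).re = (s * t).re + ((x - s).re * t) := by simp; ring
    have hx' : |(x - s).re| ≤ r := (Complex.abs_re_le_norm _).trans
      (by rw [← dist_eq_norm]; exact (Metric.mem_ball.1 hx).le)
    rw [e1, Real.exp_add]
    have e2 : Real.exp ((x - s).re * t) ≤ Real.exp ((r * t : ℂ).re) +
        Real.exp ((-r * t : ℂ).re) := by
      have := abs_le.1 hx'
      have e3 : ((r : ℂ) * t).re = r * t := by simp
      have e4 : (-(r : ℂ) * t).re = -r * t := by simp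
      rw [e3, e4]
      rcases le_total 0 t with ht | ht
      · have : Real.exp ((x - s).re * t) ≤ Real.exp (r * t) :=
          Real.exp_le_exp.2 (by nlinarith)
        have := Real.exp_pos (-r * t); linarith
      · have : Real.exp ((x - s).re * t) ≤ Real.exp (-r * t) :=
          Real.exp_le_exp.2 (by nlinarith)
        have := Real.exp_pos (r * t); linarith
    have := mul_le_mul_of_nonneg_left e2
      (by positivity : 0 ≤ ‖(t : ℂ)‖ * (‖κ t‖ * Real.exp ((s * t).re)))
    linarith
  · exact hp.norm.add hq.norm
  · refine Eventually.of_forall fun t x _ => ?_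
    have : HasDerivAt (fun x : ℂ => x * t) (1 * t) x := (hasDerivAt_id x).mul_const _
    refine (this.cexp.const_mul (κ t)).congr_deriv ?_
    ring

end ExpBound

end

section

/-- The closed horizontal strip `y₁ ≤ Im w ≤ y₂`. -/
def strip (y₁ y₂ : ℝ) : Set ℂ := {w | y₁ ≤ w.im ∧ w.im ≤ y₂}

lemma tendsto_vertical_integral {f : ℂ → ℂ} {y₁ y₂ X : ℝ} (hy : y₁ ≤ y₂) {g : ℝ → ℝ}
    (hg : Tendsto g atTop (𝓝 0))
    (hb : ∀ x : ℝ, ∀ y ∈ Icc y₁ y₂, X ≤ |x| → ‖f (x + y * Complex.I)‖ ≤ g |x|)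
    {l : Filter ℝ} (hl : Tendsto (fun x : ℝ => |x|) l atTop) :
    Tendsto (fun x : ℝ => ∫ y in y₁..y₂, f (x + y * Complex.I)) l (𝓝 0) := by
  have h1 : Tendsto (fun x : ℝ => g |x| * |y₂ - y₁|) l (𝓝 0) := by
    simpa using (hg.comp hl).mul_const |y₂ - y₁|
  refine squeeze_zero_norm' ?_ h1
  filter_upwards [hl.eventually_ge_atTop X] with x hx
  refine intervalIntegral.norm_integral_le_of_norm_le_const fun y hmem => hb x y ?_ hx
  rw [uIoc_of_le hy] at hmem
  exact Ioc_subset_Icc_self hmem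

/-- Shifting a horizontal contour inside a strip of holomorphy. -/
theorem integral_line_sub_eq_zero {f : ℂ → ℂ} {y₁ y₂ X : ℝ} (hy : y₁ ≤ y₂) {g : ℝ → ℝ}
    (hf : DifferentiableOn ℂ f (strip y₁ y₂)) (hg : Tendsto g atTop (𝓝 0))
    (hb : ∀ x : ℝ, ∀ y ∈ Icc y₁ y₂, X ≤ |x| → ‖f (x + y * Complex.I)‖ ≤ g |x|)
    (hker : Integrable fun t : ℝ => f (t + y₁ * Complex.I) - f (t + y₂ * Complex.I)) :
    ∫ t : ℝ, (f (t + y₁ * Complex.I) - f (t + y₂ * Complex.I)) = 0 := by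
  have hlim := intervalIntegral_tendsto_integral hker tendsto_neg_atTop_atBot tendsto_id
  refine tendsto_nhds_unique hlim ?_
  have hR := tendsto_vertical_integral hy hg hb (tendsto_abs_atTop_atTop)
  have hL := tendsto_vertical_integral hy hg hb (l := atBot) tendsto_abs_atBot_atTop
  have hL' := hL.comp tendsto_neg_atTop_atBot
  have := ((hL'.sub hR).const_mul Complex.I)
  rw [sub_zero, mul_zero] at this
  refine this.congr fun T => ?_
  have hline : ∀ y ∈ Icc y₁ y₂, ContinuousOn (fun t : ℝ => f (t + y * Complex.I)) univ := by
    intro y hy'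
    refine hf.continuousOn.comp (by fun_prop) fun t _ => ?_
    simpa [strip] using hy'
  have hrect := Complex.integral_boundary_rect_eq_zero_of_differentiableOn f
    (-T + y₁ * Complex.I) (T + y₂ * Complex.I) (hf.mono ?_)
  · simp at hrect
    simp only [id, Function.comp]
    rw [intervalIntegral.integral_sub]
    · push_cast
      linear_combination -hrect
    · exact ((hline y₁ ⟨le_rfl, hy⟩).mono (subset_univ _)).intervalIntegrable
    · exact ((hline y₂ ⟨hy, le_rfl⟩).mono (subset_univ _)).intervalIntegrable
  · rintro w ⟨_, hw⟩
    simpa [uIcc_of_le hy, strip] using hw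

lemma ofReal_add_mul_I_ne_zero (x : ℝ) {y : ℝ} (hy : y ≠ 0) : (x : ℂ) + y * Complex.I ≠ 0 := by
  intro h
  apply hy
  simpa using congrArg Complex.im h

lemma normSq_line (x y : ℝ) : ‖(x : ℂ) + y * Complex.I‖ ^ 2 = x ^ 2 + y ^ 2 := by
  rw [← Complex.normSq_eq_norm_sq, Complex.normSq_add_mul_I]

lemma integrable_inv_sq_add_sq {m : ℝ} (hm : 0 < m) :
    Integrable fun x : ℝ => (x ^ 2 + m ^ 2)⁻¹ := by
  have := (integrable_inv_one_add_sq.comp_div (R := m) hm.ne').const_mul (m ^ 2)⁻¹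
  refine this.congr (Eventually.of_forall fun x => ?_)
  simp only
  rw [← mul_inv]; congr 1; field_simp; ring

lemma integrable_inv_cube_line {y : ℝ} (hy : y ≠ 0) :
    Integrable fun x : ℝ => (1 : ℂ) / (x + y * Complex.I) ^ 3 := by
  have hy' : 0 < |y| := abs_pos.2 hy
  refine ((integrable_inv_sq_add_sq hy').const_mul |y|⁻¹).mono'
    (Continuous.aestronglyMeasurable ?_) (Eventually.of_forall fun x => ?_)
  · exact continuous_const.div (by fun_prop) fun x => pow_ne_zero 3 (ofReal_add_mul_I_ne_zero x hy)
  · have h1 : |y| ≤ ‖(x : ℂ) + y * Complex.I‖ := by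
      simpa using Complex.abs_im_le_norm ((x : ℂ) + y * Complex.I)
    rw [norm_div, norm_pow, pow_succ, normSq_line, sq_abs, norm_one, ← mul_inv, one_div]
    have : 0 < x ^ 2 + y ^ 2 := by positivity
    refine inv_anti₀ (by positivity) ?_
    nlinarith

lemma tendsto_inv_sq_line {y : ℝ} {l : Filter ℝ} (hl : Tendsto (fun x : ℝ => |x|) l atTop) :
    Tendsto (fun x : ℝ => (1 : ℂ) / (x + y * Complex.I) ^ 2) l (𝓝 0) := by
  rw [tendsto_zero_iff_norm_tendsto_zero]
  have : Tendsto (fun x : ℝ => (|x| ^ 2 + y ^ 2)⁻¹) l (𝓝 0) :=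
    tendsto_inv_atTop_zero.comp
      (tendsto_atTop_add_const_right _ _ ((tendsto_pow_atTop two_ne_zero).comp hl))
  refine this.congr fun x => ?_
  rw [norm_div, norm_pow, normSq_line, sq_abs, norm_one, one_div]

lemma integral_inv_cube_line {y : ℝ} (hy : y ≠ 0) :
    ∫ x : ℝ, (1 : ℂ) / (x + y * Complex.I) ^ 3 = 0 := by
  have h := integral_of_hasDerivAt_of_tendsto
    (f := fun x : ℝ => -(1 / 2) * ((1 : ℂ) / (x + y * Complex.I) ^ 2)) (m := 0) (n := 0)
    (f' := fun x : ℝ => (1 : ℂ) / (x + y * Complex.I) ^ 3) ?_ (integrable_inv_cube_line hy) ?_ ?_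
  · simpa using h
  · intro x
    have h0 := ofReal_add_mul_I_ne_zero x hy
    have h1 : HasDerivAt (fun x : ℝ => (x : ℂ) + y * Complex.I) 1 x :=
      (Complex.ofRealCLM.hasDerivAt (x := x)).add_const _
    have h2 : HasDerivAt (fun x : ℝ => -(1 / 2) * ((1 : ℂ) / (x + y * Complex.I) ^ 2))
        (-(1 / 2) * (-(((2 : ℕ) : ℂ) * (x + y * Complex.I) ^ (2 - 1) * 1) /
          ((x + y * Complex.I) ^ 2) ^ 2)) x := by
      simp only [one_div ((_ : ℂ) ^ 2)]
      exact ((h1.pow 2).inv (pow_ne_zero 2 h0)).const_mul (-(1 / 2) : ℂ)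
    refine h2.congr_deriv ?_
    simp; field_simp
  · simpa using (tendsto_inv_sq_line (y := y) tendsto_abs_atBot_atTop).const_mul (-(1 / 2) : ℂ)
  · simpa using (tendsto_inv_sq_line (y := y) tendsto_abs_atTop_atTop).const_mul (-(1 / 2) : ℂ)

lemma integrable_inv_line_sub {u v : ℝ} (hu : u ≠ 0) (hv : v ≠ 0) :
    Integrable fun x : ℝ => (1 : ℂ) / (x + u * Complex.I) - 1 / (x + v * Complex.I) := by
  have hm : 0 < min |u| |v| := lt_min (abs_pos.2 hu) (abs_pos.2 hv)
  refine ((integrable_inv_sq_add_sq hm).const_mul |v - u|).mono'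
    (Continuous.aestronglyMeasurable ?_) (Eventually.of_forall fun x => ?_)
  · exact (continuous_const.div (by fun_prop) fun x => ofReal_add_mul_I_ne_zero x hu).sub
      (continuous_const.div (by fun_prop) fun x => ofReal_add_mul_I_ne_zero x hv)
  · have e : (1 : ℂ) / (x + u * Complex.I) - 1 / (x + v * Complex.I) =
        ((v - u : ℝ) * Complex.I) / ((x + u * Complex.I) * (x + v * Complex.I)) := by
      rw [div_sub_div _ _ (ofReal_add_mul_I_ne_zero x hu) (ofReal_add_mul_I_ne_zero x hv)]
      congr 1; push_cast; ring
    rw [e, norm_div, norm_mul, norm_mul, Complex.norm_I, mul_one, Complex.norm_real,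
      Real.norm_eq_abs, div_eq_mul_inv]
    gcongr
    have h1 : x ^ 2 + min |u| |v| ^ 2 ≤ ‖(x : ℂ) + u * Complex.I‖ ^ 2 := by
      rw [normSq_line, ← sq_abs u]; gcongr; exact min_le_left _ _
    have h2 : x ^ 2 + min |u| |v| ^ 2 ≤ ‖(x : ℂ) + v * Complex.I‖ ^ 2 := by
      rw [normSq_line, ← sq_abs v]; gcongr; exact min_le_right _ _
    refine abs_le_of_sq_le_sq' ?_ (by positivity) |>.2
    rw [mul_pow, sq]
    exact mul_le_mul h1 h2 (by positivity) (by positivity)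

lemma tendsto_log_ratio {u v : ℝ} (hu : u ≠ 0) (hv : v ≠ 0) {l : Filter ℝ}
    (hl : Tendsto (fun x : ℝ => |x|) l atTop) :
    Tendsto (fun x : ℝ => Real.log (x ^ 2 + u ^ 2) - Real.log (x ^ 2 + v ^ 2)) l (𝓝 0) := by
  have h1 : Tendsto (fun x : ℝ => 1 + (u ^ 2 - v ^ 2) * (|x| ^ 2 + v ^ 2)⁻¹) l (𝓝 1) := by
    have : Tendsto (fun x : ℝ => (|x| ^ 2 + v ^ 2)⁻¹) l (𝓝 0) :=
      tendsto_inv_atTop_zero.comp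
        (tendsto_atTop_add_const_right _ _ ((tendsto_pow_atTop two_ne_zero).comp hl))
    simpa using (this.const_mul (u ^ 2 - v ^ 2)).const_add 1
  have h2 := (Real.continuousAt_log one_ne_zero).tendsto.comp h1
  rw [Real.log_one] at h2
  refine h2.congr fun x => ?_
  have p1 : 0 < x ^ 2 + u ^ 2 := by positivity
  have p2 : 0 < x ^ 2 + v ^ 2 := by positivity
  rw [← Real.log_div p1.ne' p2.ne']
  simp only [Function.comp, sq_abs]
  congr 1; field_simp; ring

lemma integral_inv_line_sub {u v : ℝ} (hu : u < 0) (hv : 0 < v) :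
    ∫ x : ℝ, ((1 : ℂ) / (x + u * Complex.I) - 1 / (x + v * Complex.I)) = 2 * π * Complex.I := by
  have hatan : ∀ w : ℝ, 0 < w → Tendsto (fun x : ℝ => Real.arctan (x / w)) atTop (𝓝 (π / 2)) ∧
      Tendsto (fun x : ℝ => Real.arctan (x / w)) atBot (𝓝 (-(π / 2))) := fun w hw =>
    ⟨(tendsto_nhds_of_tendsto_nhdsWithin Real.tendsto_arctan_atTop).comp
      (tendsto_id.atTop_div_const hw),
     (tendsto_nhds_of_tendsto_nhdsWithin Real.tendsto_arctan_atBot).comp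
      (tendsto_id.atBot_div_const hw)⟩
  have hu' : 0 < -u := by linarith
  set G : ℝ → ℝ := fun x => (Real.log (x ^ 2 + u ^ 2) - Real.log (x ^ 2 + v ^ 2)) / 2
  set A : ℝ → ℝ := fun x => Real.arctan (x / -u) + Real.arctan (x / v)
  have hG1 : Tendsto G atTop (𝓝 0) := by
    simpa using (tendsto_log_ratio hu.ne hv.ne' tendsto_abs_atTop_atTop).div_const 2
  have hG2 : Tendsto G atBot (𝓝 0) := by
    simpa using (tendsto_log_ratio hu.ne hv.ne' tendsto_abs_atBot_atTop).div_const 2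
  have hA1 : Tendsto A atTop (𝓝 π) := by
    have := (hatan _ hu').1.add (hatan _ hv).1
    rwa [add_halves] at this
  have hA2 : Tendsto A atBot (𝓝 (-π)) := by
    have := (hatan _ hu').2.add (hatan _ hv).2
    rwa [← neg_add, add_halves] at this
  have h := integral_of_hasDerivAt_of_tendsto
    (f := fun x : ℝ => (G x : ℂ) + (A x : ℂ) * Complex.I)
    (m := ((0 : ℝ) : ℂ) + ((-π : ℝ) : ℂ) * Complex.I) (n := ((0 : ℝ) : ℂ) + (π : ℝ) * Complex.I)
    (f' := fun x : ℝ => (1 : ℂ) / (x + u * Complex.I) - 1 / (x + v * Complex.I)) ?_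
    (integrable_inv_line_sub hu.ne hv.ne') ?_ ?_
  · rw [h]; push_cast; ring
  · intro x
    have hu0 := hu.ne
    have p1 : x ^ 2 + u ^ 2 ≠ 0 := by positivity
    have p2 : x ^ 2 + v ^ 2 ≠ 0 := by positivity
    have d0 : ∀ w : ℝ, HasDerivAt (fun x : ℝ => x ^ 2 + w ^ 2) (2 * x) x := fun w => by
      simpa using (hasDerivAt_pow 2 x).add_const (w ^ 2)
    have dG : HasDerivAt G _ x := (((d0 u).log p1).sub ((d0 v).log p2)).div_const 2
    have d1 : ∀ w : ℝ, HasDerivAt (fun x : ℝ => x / w) (1 / w) x :=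
      fun w => (hasDerivAt_id x).div_const w
    have dA : HasDerivAt A _ x := ((d1 (-u)).arctan).add ((d1 v).arctan)
    refine (dG.ofReal_comp.add (dA.ofReal_comp.mul_const Complex.I)).congr_deriv ?_
    have q1 := ofReal_add_mul_I_ne_zero x hu.ne
    have q2 := ofReal_add_mul_I_ne_zero x hv.ne'
    have conj : ∀ w : ℝ, w ≠ 0 → (1 : ℂ) / (x + w * Complex.I) =
        ((x / (x ^ 2 + w ^ 2) : ℝ) : ℂ) - ((w / (x ^ 2 + w ^ 2) : ℝ) : ℂ) * Complex.I := by
      intro w hw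
      have p : ((x : ℂ) ^ 2 + (w : ℂ) ^ 2) ≠ 0 := by
        have : x ^ 2 + w ^ 2 ≠ 0 := by positivity
        exact_mod_cast this
      rw [div_eq_iff (ofReal_add_mul_I_ne_zero x hw)]
      push_cast
      field_simp
      linear_combination ((w : ℂ) ^ 2) * Complex.I_sq
    rw [conj u hu.ne, conj v hv.ne']
    have r1 : 1 / (1 + (x / -u) ^ 2) * (1 / -u) = -(u / (x ^ 2 + u ^ 2)) := by
      have := hu.ne
      field_simp; ring
    have r2 : 1 / (1 + (x / v) ^ 2) * (1 / v) = v / (x ^ 2 + v ^ 2) := by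
      field_simp; ring
    rw [r1, r2]
    push_cast; ring
  · exact ((Complex.continuous_ofReal.tendsto _).comp hG2).add
      (((Complex.continuous_ofReal.tendsto _).comp hA2).mul_const _)
  · exact ((Complex.continuous_ofReal.tendsto _).comp hG1).add
      (((Complex.continuous_ofReal.tendsto _).comp hA1).mul_const _)

/-- Shifting a horizontal contour across a pole on the imaginary axis whose polar part is
`A / (w - p) ^ 3 + r / (w - p)`. -/
theorem integral_line_sub_eq_residue {k : ℂ → ℂ} {A r : ℂ} {q y₁ y₂ X : ℝ} (h₁ : y₁ < q)
    (h₂ : q < y₂) {g : ℝ → ℝ}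
    (hk : DifferentiableOn ℂ k (strip y₁ y₂ \ {q * Complex.I}))
    (hres : Tendsto (fun w => (w - q * Complex.I) * k w - A / (w - q * Complex.I) ^ 2)
      (𝓝[≠] (q * Complex.I)) (𝓝 r))
    (hg : Tendsto g atTop (𝓝 0))
    (hb : ∀ x : ℝ, ∀ y ∈ Icc y₁ y₂, X ≤ |x| → ‖k (x + y * Complex.I)‖ ≤ g |x|)
    (hi₁ : Integrable fun t : ℝ => k (t + y₁ * Complex.I))
    (hi₂ : Integrable fun t : ℝ => k (t + y₂ * Complex.I)) :
    (∫ t : ℝ, k (t + y₁ * Complex.I)) - ∫ t : ℝ, k (t + y₂ * Complex.I) =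
      2 * π * Complex.I * r := by
  set p : ℂ := q * Complex.I with hp
  set h₀ : ℂ → ℂ := fun w => k w - A * (1 / (w - p) ^ 3) - r * (1 / (w - p)) with hh₀
  set h : ℂ → ℂ := Function.update h₀ p (limUnder (𝓝[≠] p) h₀) with hh
  have hnhds : strip y₁ y₂ ∈ 𝓝 p := by
    have : IsOpen {w : ℂ | y₁ < w.im ∧ w.im < y₂} :=
      (isOpen_lt continuous_const Complex.continuous_im).inter
        (isOpen_lt Complex.continuous_im continuous_const)
    refine mem_of_superset (this.mem_nhds ?_) fun w hw => ⟨hw.1.le, hw.2.le⟩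
    simp [hp, h₁, h₂]
  have hd : DifferentiableOn ℂ h (strip y₁ y₂) := by
    refine Complex.differentiableOn_update_limUnder_of_isLittleO hnhds ?_ ?_
    · intro w hw
      have : w - p ≠ 0 := sub_ne_zero.2 hw.2
      refine ((hk w hw).sub ?_).sub ?_
      · exact (DifferentiableAt.const_mul (DifferentiableAt.div (d := fun w => (w - p) ^ 3)
          (by fun_prop) (by fun_prop) (pow_ne_zero 3 this)) A).differentiableWithinAt
      · exact (DifferentiableAt.const_mul (DifferentiableAt.div (d := fun w => w - p)
          (by fun_prop) (by fun_prop) this) r).differentiableWithinAt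
    · rw [Asymptotics.isLittleO_iff_tendsto']
      · have t1 : Tendsto (fun w => w - p) (𝓝[≠] p) (𝓝 0) := by
          have : Tendsto (fun w => w - p) (𝓝 p) (𝓝 (p - p)) := by
            exact (continuous_id.sub continuous_const).tendsto p
          rw [sub_self] at this
          exact this.mono_left nhdsWithin_le_nhds
        have t2 := (hres.sub_const r).sub (t1.mul_const (h₀ p))
        rw [sub_self, zero_mul, sub_zero] at t2
        refine t2.congr' ?_
        filter_upwards [self_mem_nhdsWithin] with w hw
        have : w - p ≠ 0 := sub_ne_zero.2 hw
        simp only [hh₀]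
        field_simp
      · filter_upwards [self_mem_nhdsWithin] with w hw h0
        exact absurd (inv_eq_zero.1 h0) (sub_ne_zero.2 hw)
  have hline : ∀ (x y : ℝ), y ≠ q ∨ x ≠ 0 → h (x + y * Complex.I) = k (x + y * Complex.I) -
      A * (1 / ((x : ℂ) + (y - q : ℝ) * Complex.I) ^ 3) -
      r * (1 / ((x : ℂ) + (y - q : ℝ) * Complex.I)) := by
    intro x y hxy
    have hne : (x : ℂ) + y * Complex.I ≠ p := by
      intro h
      rcases hxy with h' | h'
      · exact h' (by simpa [hp] using congrArg Complex.im h)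
      · exact h' (by simpa [hp] using congrArg Complex.re h)
    rw [hh, Function.update_of_ne hne]
    have : (x : ℂ) + y * Complex.I - p = (x : ℂ) + (y - q : ℝ) * Complex.I := by
      rw [hp]; push_cast; ring
    simp only [hh₀, this]
  have a₁ : y₁ - q ≠ 0 := by linarith
  have a₂ : y₂ - q ≠ 0 := by linarith
  have hdiff : ∀ t : ℝ, h (t + y₁ * Complex.I) - h (t + y₂ * Complex.I) =
      (k (t + y₁ * Complex.I) - k (t + y₂ * Complex.I)) -
      A * (1 / ((t : ℂ) + (y₁ - q : ℝ) * Complex.I) ^ 3 -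
        1 / ((t : ℂ) + (y₂ - q : ℝ) * Complex.I) ^ 3) -
      r * (1 / ((t : ℂ) + (y₁ - q : ℝ) * Complex.I) -
        1 / ((t : ℂ) + (y₂ - q : ℝ) * Complex.I)) := by
    intro t
    rw [hline t y₁ (Or.inl h₁.ne), hline t y₂ (Or.inl h₂.ne')]; ring
  have i1 : Integrable fun t : ℝ => k (t + y₁ * Complex.I) - k (t + y₂ * Complex.I) :=
    hi₁.sub hi₂
  have i2 : Integrable fun t : ℝ => A * (1 / ((t : ℂ) + (y₁ - q : ℝ) * Complex.I) ^ 3 -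
      1 / ((t : ℂ) + (y₂ - q : ℝ) * Complex.I) ^ 3) :=
    ((integrable_inv_cube_line a₁).sub (integrable_inv_cube_line a₂)).const_mul A
  have i12 : Integrable fun t : ℝ => (k (t + y₁ * Complex.I) - k (t + y₂ * Complex.I)) -
      A * (1 / ((t : ℂ) + (y₁ - q : ℝ) * Complex.I) ^ 3 -
        1 / ((t : ℂ) + (y₂ - q : ℝ) * Complex.I) ^ 3) := i1.sub i2
  have i3 := (integrable_inv_line_sub a₁ a₂).const_mul r
  have hker : Integrable fun t : ℝ => h (t + y₁ * Complex.I) - h (t + y₂ * Complex.I) := by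
    simp only [hdiff]; exact i12.sub i3
  have hz := integral_line_sub_eq_zero (X := max X 1)
    (g := fun x => g x + ‖A‖ * (1 / x) + ‖r‖ * (1 / x)) (h₁.trans h₂).le hd ?_ ?_ hker
  · simp only [hdiff] at hz
    rw [integral_sub i12 i3, integral_sub i1 i2, integral_const_mul, integral_const_mul,
      integral_inv_line_sub (by linarith) (by linarith),
      integral_sub (integrable_inv_cube_line a₁) (integrable_inv_cube_line a₂),
      integral_inv_cube_line a₁, integral_inv_cube_line a₂, integral_sub hi₁ hi₂] at hz
    linear_combination hz
  · have : Tendsto (fun x : ℝ => 1 / x) atTop (𝓝 0) := by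
      simpa using tendsto_inv_atTop_zero (𝕜 := ℝ)
    simpa using (hg.add (this.const_mul ‖A‖)).add (this.const_mul ‖r‖)
  · intro x y hy hx
    have hx1 : 1 ≤ |x| := (le_max_right _ _).trans hx
    have hx0 : x ≠ 0 := by intro h; rw [h, abs_zero] at hx1; linarith
    rw [hline x y (Or.inr hx0)]
    have hn : |x| ≤ ‖(x : ℂ) + (y - q : ℝ) * Complex.I‖ := by
      simpa using Complex.abs_re_le_norm ((x : ℂ) + (y - q : ℝ) * Complex.I)
    have hinv : ‖(1 : ℂ) / ((x : ℂ) + (y - q : ℝ) * Complex.I)‖ ≤ 1 / |x| := by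
      rw [norm_div, norm_one]; gcongr
    have hinv3 : ‖(1 : ℂ) / ((x : ℂ) + (y - q : ℝ) * Complex.I) ^ 3‖ ≤ 1 / |x| := by
      rw [norm_div, norm_one, norm_pow]; gcongr
      exact hn.trans (le_self_pow₀ (hx1.trans hn) (by norm_num))
    refine (norm_sub_le _ _).trans (add_le_add ((norm_sub_le _ _).trans (add_le_add
      (hb x y hy ((le_max_left _ _).trans hx)) ?_)) ?_)
    · rw [norm_mul]; exact mul_le_mul_of_nonneg_left hinv3 (norm_nonneg _)
    · rw [norm_mul]; exact mul_le_mul_of_nonneg_left hinv (norm_nonneg _)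

end

section

lemma normSq_sinh (x y : ℝ) :
    ‖Complex.sinh (x + y * Complex.I)‖ ^ 2 = Real.sinh x ^ 2 + Real.sin y ^ 2 := by
  rw [Complex.sinh_add, Complex.cosh_mul_I, Complex.sinh_mul_I, ← Complex.ofReal_sinh,
    ← Complex.ofReal_cosh, ← Complex.ofReal_cos, ← Complex.ofReal_sin, ← mul_assoc,
    ← Complex.ofReal_mul, ← Complex.ofReal_mul, normSq_line]
  have h1 := Real.cosh_sq x
  have h2 := Real.sin_sq_add_cos_sq y
  linear_combination (Real.sinh x ^ 2 ) * h2 + (Real.sin y ^ 2) * h1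

lemma exp_abs_le_two_mul_cosh (x : ℝ) : Real.exp |x| ≤ 2 * Real.cosh x := by
  rw [← Real.cosh_abs, Real.cosh_eq]
  have := Real.exp_pos (-|x|)
  linarith

lemma le_norm_sinh (x y : ℝ) :
    |Real.sin y| / 2 * Real.exp |x| ≤ ‖Complex.sinh (x + y * Complex.I)‖ := by
  have h1 : |Real.sin y| * Real.cosh x ≤ ‖Complex.sinh (x + y * Complex.I)‖ := by
    refine abs_le_of_sq_le_sq' ?_ (norm_nonneg _) |>.2
    rw [normSq_sinh, mul_pow, sq_abs, Real.cosh_sq]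
    nlinarith [Real.sin_sq_le_one y, sq_nonneg (Real.sinh x)]
  have := exp_abs_le_two_mul_cosh x
  nlinarith [abs_nonneg (Real.sin y)]

lemma le_norm_sinh_of_one_le_abs {x : ℝ} (hx : 1 ≤ |x|) (y : ℝ) :
    Real.exp |x| / 4 ≤ ‖Complex.sinh (x + y * Complex.I)‖ := by
  refine abs_le_of_sq_le_sq' ?_ (norm_nonneg _) |>.2
  rw [normSq_sinh, ← sq_abs (Real.sinh x), Real.abs_sinh, Real.sinh_eq, Real.exp_neg]
  have h1 : 2 ≤ Real.exp |x| := by linarith [Real.add_one_le_exp |x|]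
  have h2 : (Real.exp |x|)⁻¹ ≤ 1 / 2 := by
    rw [inv_eq_one_div]; exact one_div_le_one_div_of_le (by norm_num) h1
  have h3 : Real.exp |x| / 4 ≤ (Real.exp |x| - (Real.exp |x|)⁻¹) / 2 := by linarith
  have := pow_le_pow_left₀ (by positivity) h3 2
  nlinarith [sq_nonneg (Real.sin y)]

/-- The height of the contour defining `PhiS`. -/
def height (B : ℝ) : ℝ := π * min B B⁻¹ / 2

/-- The half-width of the strip of definition of `PhiS`. -/
def hw (B : ℝ) : ℝ := (B + B⁻¹) / 2

/-- A point of the contour defining `PhiS`. -/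
def pt (B t : ℝ) : ℂ := t + height B * Complex.I

/-- The open strip `|Im z| < hw B`. -/
def dom (B : ℝ) : Set ℂ := {z | |z.im| < hw B}

variable {B : ℝ}

lemma height_pos (hB : 0 < B) : 0 < height B := by
  have : 0 < min B B⁻¹ := lt_min hB (inv_pos.2 hB)
  unfold height; positivity

lemma hw_pos (hB : 0 < B) : 0 < hw B := by unfold hw; positivity

lemma height_mul_lt (hB : 0 < B) : height B * B < π := by
  have h : min B B⁻¹ * B ≤ 1 := by
    calc _ ≤ B⁻¹ * B := mul_le_mul_of_nonneg_right (min_le_right _ _) hB.le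
      _ = 1 := inv_mul_cancel₀ hB.ne'
  unfold height; nlinarith [Real.pi_pos]

lemma height_div_lt (hB : 0 < B) : height B / B < π := by
  have h : min B B⁻¹ / B ≤ 1 := by
    rw [div_le_one hB]; exact min_le_left _ _
  have : height B / B = π * (min B B⁻¹ / B) / 2 := by unfold height; ring
  rw [this]; nlinarith [Real.pi_pos]

lemma isOpen_dom : IsOpen (dom B) :=
  isOpen_lt (continuous_abs.comp Complex.continuous_im) continuous_const

lemma sinh_pt_mul (hB : 0 < B) (t : ℝ) :
    |Real.sin (height B * B)| / 2 * Real.exp (B * |t|) ≤ ‖Complex.sinh (pt B t * B)‖ := by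
  have := le_norm_sinh (t * B) (height B * B)
  rw [abs_mul, abs_of_pos hB, mul_comm |t| B] at this
  convert this using 3
  unfold pt; push_cast; ring

lemma sinh_pt_div (hB : 0 < B) (t : ℝ) :
    |Real.sin (height B / B)| / 2 * Real.exp (B⁻¹ * |t|) ≤ ‖Complex.sinh (pt B t / B)‖ := by
  have := le_norm_sinh (t / B) (height B / B)
  rw [abs_div, abs_of_pos hB, div_eq_inv_mul |t| B] at this
  convert this using 3
  unfold pt; push_cast; ring

lemma sin_mul_pos (hB : 0 < B) : 0 < |Real.sin (height B * B)| :=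
  abs_pos.2 (Real.sin_pos_of_pos_of_lt_pi (mul_pos (height_pos hB) hB) (height_mul_lt hB)).ne'

lemma sin_div_pos (hB : 0 < B) : 0 < |Real.sin (height B / B)| :=
  abs_pos.2 (Real.sin_pos_of_pos_of_lt_pi (div_pos (height_pos hB) hB) (height_div_lt hB)).ne'

lemma sinh_pt_mul_ne_zero (hB : 0 < B) (t : ℝ) : Complex.sinh (pt B t * B) ≠ 0 := by
  have := sin_mul_pos hB
  exact norm_pos_iff.1 (lt_of_lt_of_le (by positivity) (sinh_pt_mul hB t))

lemma sinh_pt_div_ne_zero (hB : 0 < B) (t : ℝ) : Complex.sinh (pt B t / B) ≠ 0 := by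
  have := sin_div_pos hB
  exact norm_pos_iff.1 (lt_of_lt_of_le (by positivity) (sinh_pt_div hB t))

lemma pt_ne_zero (hB : 0 < B) (t : ℝ) : pt B t ≠ 0 :=
  ofReal_add_mul_I_ne_zero t (height_pos hB).ne'

lemma height_le_norm_pt (hB : 0 < B) (t : ℝ) : height B ≤ ‖pt B t‖ := by
  have := Complex.abs_im_le_norm (pt B t)
  simpa [pt, abs_of_pos (height_pos hB)] using this

/-- The `z`-independent factor of the kernel on the contour. -/
def amp (B t : ℝ) : ℂ :=
  1 / (4 * Complex.sinh (pt B t * B) * Complex.sinh (pt B t / B) * pt B t)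

lemma continuous_amp (hB : 0 < B) : Continuous (amp B) := by
  unfold amp
  refine continuous_const.div (by unfold pt; fun_prop) fun t => ?_
  exact mul_ne_zero (mul_ne_zero (mul_ne_zero (by norm_num : (4 : ℂ) ≠ 0)
    (sinh_pt_mul_ne_zero hB t))
    (sinh_pt_div_ne_zero hB t)) (pt_ne_zero hB t)

lemma expBound_of_abs {κ : ℝ → ℂ} {C α : ℝ} (hκ : Continuous κ) (hα : 0 ≤ α)
    (h : ∀ t, ‖κ t‖ ≤ C * Real.exp (-(α * |t|))) : ExpBound κ C α α := by
  have hC : 0 ≤ C := by simpa using (norm_nonneg _).trans (h 0)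
  refine ⟨hκ, fun t => (h t).trans ?_, fun t => (h t).trans ?_⟩ <;>
    refine mul_le_mul_of_nonneg_left (Real.exp_le_exp.2 ?_) hC
  · nlinarith [le_abs_self t]
  · nlinarith [neg_abs_le t]

lemma expBound_amp (hB : 0 < B) : ∃ C, ExpBound (amp B) C (2 * hw B) (2 * hw B) := by
  have s1 := sin_mul_pos hB
  have s2 := sin_div_pos hB
  have hh := height_pos hB
  refine ⟨1 / (4 * (|Real.sin (height B * B)| / 2) * (|Real.sin (height B / B)| / 2) * height B),
    expBound_of_abs (continuous_amp hB) (by have := hw_pos hB; linarith) fun t => ?_⟩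
  have e : Real.exp (-(2 * hw B * |t|)) =
      (Real.exp (B * |t|))⁻¹ * (Real.exp (B⁻¹ * |t|))⁻¹ := by
    rw [← Real.exp_neg, ← Real.exp_neg, ← Real.exp_add]; congr 1; unfold hw; ring
  rw [amp, norm_div, norm_one, e, one_div, one_div, ← mul_inv,
    ← mul_inv]
  refine inv_anti₀ (by positivity) ?_
  rw [norm_mul, norm_mul, norm_mul, Complex.norm_ofNat]
  calc _ = 4 * (|Real.sin (height B * B)| / 2 * Real.exp (B * |t|)) *
        (|Real.sin (height B / B)| / 2 * Real.exp (B⁻¹ * |t|)) * height B := by ring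
    _ ≤ _ := by
      have := sinh_pt_mul hB t
      have := sinh_pt_div hB t
      have := height_le_norm_pt hB t
      gcongr

lemma contour_eq (B t : ℝ) :
    (t : ℂ) + Complex.I * (π * (min B B⁻¹ : ℝ) / 2) = pt B t := by
  unfold pt height; push_cast; ring

/-- The logarithm of `PhiS`. -/
def logPhi (B : ℝ) (z : ℂ) : ℂ := ∫ t : ℝ, phiKer B z (pt B t)

/-- The derivative of `logPhi`. -/
def dlogPhi (B : ℝ) (z : ℂ) : ℂ := ∫ t : ℝ, -2 * Complex.I * pt B t * phiKer B z (pt B t)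

lemma PhiS_eq (B : ℝ) (z : ℂ) : PhiS B z = Complex.exp (logPhi B z) := by
  unfold PhiS logPhi
  simp only [contour_eq]

lemma phiKer_pt (z : ℂ) (t : ℝ) : phiKer B z (pt B t) =
    Complex.exp (2 * height B * z) * (amp B t * Complex.exp (-2 * Complex.I * z * t)) := by
  have : Complex.exp (-2 * Complex.I * z * pt B t) =
      Complex.exp (2 * height B * z) * Complex.exp (-2 * Complex.I * z * t) := by
    rw [← Complex.exp_add]; congr 1; unfold pt
    linear_combination (-2 * z * height B) * Complex.I_sq
  rw [phiKer, this, amp]; ring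

lemma re_neg_two_I_mul (z : ℂ) : (-2 * Complex.I * z).re = 2 * z.im := by simp

lemma laplace_norm_le {κ : ℝ → ℂ} {C α y : ℝ} (h : ExpBound κ C α α) {s : ℂ}
    (hs : |s.re| ≤ y) (hy : y < α) :
    ‖∫ t : ℝ, κ t * Complex.exp (s * t)‖ ≤ C * (2 / (α - y)) := by
  have := abs_le.1 hs
  refine ((h.mul_exp s).norm_integral_le (by linarith) (by linarith)).trans ?_
  refine mul_le_mul_of_nonneg_left ?_ h.nonneg
  have e1 : 1 / (α - s.re) ≤ 1 / (α - y) := one_div_le_one_div_of_le (by linarith) (by linarith)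
  have e2 : 1 / (α + s.re) ≤ 1 / (α - y) := one_div_le_one_div_of_le (by linarith) (by linarith)
  calc _ ≤ 1 / (α - y) + 1 / (α - y) := add_le_add e1 e2
    _ = _ := by ring

lemma integrable_phiKer (hB : 0 < B) {z : ℂ} (hz : z ∈ dom B) :
    Integrable fun t : ℝ => phiKer B z (pt B t) := by
  obtain ⟨C, hC⟩ := expBound_amp hB
  simp only [phiKer_pt]
  have := abs_lt.1 hz.out
  exact ((hC.mul_exp _).integrable (by rw [re_neg_two_I_mul]; linarith)
    (by rw [re_neg_two_I_mul]; linarith)).const_mul _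

lemma integrable_mul_phiKer (hB : 0 < B) {z : ℂ} (hz : z ∈ dom B) :
    Integrable fun t : ℝ => -2 * Complex.I * pt B t * phiKer B z (pt B t) := by
  obtain ⟨C, hC⟩ := expBound_amp hB
  have hz' := abs_lt.1 hz.out
  have hl := hC.linear_mul (η := hw B - |z.im|) (by linarith [hz.out])
    (by linarith [hw_pos hB, abs_nonneg z.im]) (-2 * Complex.I) (2 * height B)
  have := ((hl.mul_exp (-2 * Complex.I * z)).integrable ?_ ?_).const_mul
    (Complex.exp (2 * height B * z))
  · refine this.congr (Eventually.of_forall fun t => ?_)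
    simp only [phiKer_pt]
    unfold pt
    linear_combination (2 * height B * Complex.exp (2 * height B * z) * amp B t *
      Complex.exp (-2 * Complex.I * z * t)) * Complex.I_sq
  · rw [re_neg_two_I_mul]; linarith [le_abs_self z.im, hz.out]
  · rw [re_neg_two_I_mul]; linarith [neg_abs_le z.im, hz.out]

lemma hasDerivAt_logPhi (hB : 0 < B) {z : ℂ} (hz : z ∈ dom B) :
    HasDerivAt (logPhi B) (dlogPhi B z) z := by
  obtain ⟨C, hC⟩ := expBound_amp hB
  have hz' := abs_lt.1 hz.out
  have h1 : logPhi B = fun z => Complex.exp (2 * height B * z) *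
      ∫ t : ℝ, amp B t * Complex.exp (-2 * Complex.I * z * t) := by
    funext z; unfold logPhi; simp only [phiKer_pt]; rw [integral_const_mul]
  have h2 : HasDerivAt (fun s : ℂ => ∫ t : ℝ, amp B t * Complex.exp (s * t))
      (∫ t : ℝ, t * amp B t * Complex.exp (-2 * Complex.I * z * t)) (-2 * Complex.I * z) :=
    hC.hasDerivAt_laplace (by rw [re_neg_two_I_mul]; linarith) (by rw [re_neg_two_I_mul]; linarith)
  have h3 : HasDerivAt (fun z : ℂ => -2 * Complex.I * z) (-2 * Complex.I) z := by
    simpa using (hasDerivAt_id z).const_mul (-2 * Complex.I)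
  have h4 : HasDerivAt (fun z : ℂ => 2 * (height B : ℂ) * z) (2 * height B) z := by
    simpa using (hasDerivAt_id z).const_mul (2 * (height B : ℂ))
  rw [h1]
  refine (h4.cexp.mul (h2.comp z h3)).congr_deriv ?_
  have i0 := (integrable_phiKer hB hz).const_mul (2 * (height B : ℂ))
  have i1 : Integrable fun t : ℝ =>
      -2 * Complex.I * pt B t * phiKer B z (pt B t) - 2 * (height B : ℂ) * phiKer B z (pt B t) :=
    (integrable_mul_phiKer hB hz).sub i0
  have e : dlogPhi B z = (∫ t : ℝ, 2 * (height B : ℂ) * phiKer B z (pt B t)) +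
      ∫ t : ℝ, (-2 * Complex.I * pt B t * phiKer B z (pt B t) -
        2 * (height B : ℂ) * phiKer B z (pt B t)) := by
    rw [← integral_add i0 i1]; unfold dlogPhi; congr 1; funext t; ring
  have e2 : ∀ t : ℝ, -2 * Complex.I * pt B t * phiKer B z (pt B t) -
      2 * (height B : ℂ) * phiKer B z (pt B t) = (-2 * Complex.I * Complex.exp (2 * height B * z)) *
        (t * amp B t * Complex.exp (-2 * Complex.I * z * t)) := by
    intro t
    rw [phiKer_pt]; unfold pt
    linear_combination (-2 * height B * Complex.exp (2 * height B * z) * amp B t *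
      Complex.exp (-2 * Complex.I * z * t)) * Complex.I_sq
  rw [e]
  simp only [e2, Function.comp]
  rw [integral_const_mul, integral_const_mul]
  simp only [phiKer_pt]
  rw [integral_const_mul]
  ring

lemma norm_exp_height (z : ℂ) :
    ‖Complex.exp (2 * height B * z)‖ = Real.exp (2 * height B * z.re) := by
  rw [Complex.norm_exp]; congr 1; simp

lemma logPhi_bounds (hB : 0 < B) {y : ℝ} (hy : y < hw B) : ∃ C, 0 ≤ C ∧ ∀ z : ℂ, |z.im| ≤ y →
    ‖logPhi B z‖ ≤ C * Real.exp (2 * height B * z.re) ∧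
    ‖dlogPhi B z‖ ≤ C * Real.exp (2 * height B * z.re) := by
  obtain ⟨C, hC⟩ := expBound_amp hB
  rcases lt_or_ge y 0 with hy0 | hy0
  · exact ⟨0, le_rfl, fun z hz => absurd (abs_nonneg z.im) (by linarith)⟩
  have hl := hC.linear_mul (η := hw B - y) (by linarith) (by linarith [hw_pos hB])
    (-2 * Complex.I) (2 * height B)
  set C' := (‖-2 * Complex.I‖ / (hw B - y) + ‖(2 * height B : ℂ)‖) * C
  have hC0 := hC.nonneg
  have hC1 : 0 ≤ C' := hl.nonneg
  have hd : 0 < hw B - y := by linarith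
  refine ⟨C * (2 / (2 * hw B - 2 * y)) + C' * (2 / (2 * hw B - (hw B - y) - 2 * y)), ?_,
    fun z hz => ⟨?_, ?_⟩⟩
  · have h1 : 0 < 2 * hw B - 2 * y := by linarith
    have h2 : 0 < 2 * hw B - (hw B - y) - 2 * y := by linarith
    positivity
  all_goals
    have h1 : 0 < 2 * hw B - 2 * y := by linarith
    have h2 : 0 < 2 * hw B - (hw B - y) - 2 * y := by linarith
    have hs : |(-2 * Complex.I * z).re| ≤ 2 * y := by
      rw [re_neg_two_I_mul, abs_mul, abs_two]; linarith
  · unfold logPhi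
    simp only [phiKer_pt]
    rw [integral_const_mul, norm_mul, norm_exp_height, mul_comm]
    refine mul_le_mul_of_nonneg_right ?_ (Real.exp_pos _).le
    refine (laplace_norm_le hC hs (by linarith)).trans (le_add_of_nonneg_right (by positivity))
  · unfold dlogPhi
    have e : ∀ t : ℝ, -2 * Complex.I * pt B t * phiKer B z (pt B t) =
        Complex.exp (2 * height B * z) * ((-2 * Complex.I * t + 2 * height B) * amp B t *
          Complex.exp (-2 * Complex.I * z * t)) := by
      intro t
      rw [phiKer_pt]; unfold pt
      linear_combination (-2 * height B * Complex.exp (2 * height B * z) * amp B t *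
        Complex.exp (-2 * Complex.I * z * t)) * Complex.I_sq
    simp only [e]
    rw [integral_const_mul, norm_mul, norm_exp_height, mul_comm]
    refine mul_le_mul_of_nonneg_right ?_ (Real.exp_pos _).le
    refine (laplace_norm_le hl hs (by linarith)).trans (le_add_of_nonneg_left (by positivity))

end

section

variable {B : ℝ}

lemma phiKer_inv (B : ℝ) (z w : ℂ) : phiKer B⁻¹ z w = phiKer B z w := by
  unfold phiKer
  push_cast
  rw [div_inv_eq_mul, ← div_eq_mul_inv]
  ring

lemma height_inv (B : ℝ) : height B⁻¹ = height B := by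
  unfold height; rw [inv_inv, min_comm]

lemma hw_inv (B : ℝ) : hw B⁻¹ = hw B := by unfold hw; rw [inv_inv]; ring

lemma logPhi_inv (B : ℝ) (z : ℂ) : logPhi B⁻¹ z = logPhi B z := by
  unfold logPhi pt; simp only [phiKer_inv, height_inv]

lemma PhiS_inv (B : ℝ) (z : ℂ) : PhiS B⁻¹ z = PhiS B z := by
  rw [PhiS_eq, PhiS_eq, logPhi_inv]

lemma one_add_exp_ne_zero {u : ℂ} (hu : |u.im| < π) : 1 + Complex.exp u ≠ 0 := by
  intro h
  have h1 : Complex.exp u = -1 := by linear_combination h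
  have h2 := abs_lt.1 hu
  have h3 := Complex.log_exp h2.1 h2.2.le
  rw [h1, Complex.log_neg_one] at h3
  rw [← h3] at h2
  simp at h2

lemma im_mem_dom {z : ℂ} (hz : |z.im| < (2 * B)⁻¹) :
    z - Complex.I * B / 2 ∈ dom B ∧ z + Complex.I * B / 2 ∈ dom B := by
  have := abs_lt.1 hz
  have h0 : 0 < (2 * B)⁻¹ := (abs_nonneg _).trans_lt hz
  have hB : 0 < B := by have := inv_pos.1 h0; linarith
  have e : (2 * B)⁻¹ = B⁻¹ / 2 := by rw [mul_inv]; ring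
  rw [e] at this
  have e1 : (z - Complex.I * B / 2).im = z.im - B / 2 := by simp
  have e2 : (z + Complex.I * B / 2).im = z.im + B / 2 := by simp
  constructor
  · rw [dom, mem_ofPred_eq, e1, abs_lt]; unfold hw; constructor <;> linarith
  · rw [dom, mem_ofPred_eq, e2, abs_lt]; unfold hw; constructor <;> linarith

/-- The kernel of the derivative of the logarithm of the functional equation. -/
def shiftKer (B : ℝ) (z w : ℂ) : ℂ := Complex.exp (-2 * Complex.I * z * w) / Complex.sinh (w / B)

lemma shiftKer_pt (hB : 0 < B) (z : ℂ) (t : ℝ) :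
    -2 * Complex.I * pt B t * phiKer B (z - Complex.I * B / 2) (pt B t) -
      -2 * Complex.I * pt B t * phiKer B (z + Complex.I * B / 2) (pt B t) =
      Complex.I * shiftKer B z (pt B t) := by
  have h1 := sinh_pt_mul_ne_zero hB t
  have h2 := sinh_pt_div_ne_zero hB t
  have h3 := pt_ne_zero hB t
  unfold phiKer shiftKer
  set w := pt B t
  have e1 : Complex.exp (-2 * Complex.I * (z - Complex.I * B / 2) * w) =
      Complex.exp (-2 * Complex.I * z * w) * Complex.exp (-(w * B)) := by
    rw [← Complex.exp_add]; congr 1; linear_combination (B * w) * Complex.I_sq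
  have e2 : Complex.exp (-2 * Complex.I * (z + Complex.I * B / 2) * w) =
      Complex.exp (-2 * Complex.I * z * w) * Complex.exp (w * B) := by
    rw [← Complex.exp_add]; congr 1; linear_combination (-B * w) * Complex.I_sq
  have e3 : Complex.exp (w * B) - Complex.exp (-(w * B)) = 2 * Complex.sinh (w * B) := by
    rw [Complex.two_sinh]
  rw [e1, e2]
  field_simp
  linear_combination 2 * e3

lemma shiftKer_add (hB : 0 < B) (z w : ℂ) :
    shiftKer B z (w + π * B * Complex.I) = -Complex.exp (2 * π * B * z) * shiftKer B z w := by
  unfold shiftKer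
  have h0 : (B : ℂ) ≠ 0 := by exact_mod_cast hB.ne'
  have e1 : (w + π * B * Complex.I) / B = w / B + π * Complex.I := by field_simp
  have e2 : Complex.exp (-2 * Complex.I * z * (w + π * B * Complex.I)) =
      Complex.exp (2 * π * B * z) * Complex.exp (-2 * Complex.I * z * w) := by
    rw [← Complex.exp_add]; congr 1; linear_combination (-2 * z * π * B) * Complex.I_sq
  rw [e1, e2, Complex.sinh_add, Complex.cosh_mul_I, Complex.sinh_mul_I, Complex.cos_pi,
    Complex.sin_pi]
  rw [zero_mul, mul_zero, add_zero, mul_neg_one, div_neg]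
  ring

lemma tendsto_exp_neg_mul_atTop {α : ℝ} (hα : 0 < α) (C : ℝ) :
    Tendsto (fun x : ℝ => C * Real.exp (-(α * x))) atTop (𝓝 0) := by
  have : Tendsto (fun x : ℝ => Real.exp (-(α * x))) atTop (𝓝 0) :=
    Real.tendsto_exp_neg_atTop_nhds_zero.comp (tendsto_id.const_mul_atTop hα)
  simpa using this.const_mul C

lemma sinh_ne_zero_of_im {w : ℂ} (h0 : Real.sin w.im ≠ 0) : Complex.sinh w ≠ 0 := by
  have := le_norm_sinh w.re w.im
  rw [Complex.re_add_im] at this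
  refine norm_pos_iff.1 (lt_of_lt_of_le ?_ this)
  have := abs_pos.2 h0
  positivity

lemma sinh_ne_zero_of_re {w : ℂ} (h0 : w.re ≠ 0) : Complex.sinh w ≠ 0 := by
  have := normSq_sinh w.re w.im
  rw [Complex.re_add_im] at this
  intro h
  rw [h, norm_zero] at this
  have h1 : Real.sinh w.re ≠ 0 := fun h => h0 (Real.sinh_eq_zero.1 h)
  have : 0 < Real.sinh w.re ^ 2 := by positivity
  nlinarith [sq_nonneg (Real.sin w.im)]

lemma norm_exp_neg_two_I (z : ℂ) (x y : ℝ) :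
    ‖Complex.exp (-2 * Complex.I * z * (x + y * Complex.I))‖ =
      Real.exp (2 * z.im * x + 2 * z.re * y) := by
  rw [Complex.norm_exp]; congr 1
  simp; ring

lemma norm_exp_neg_two_I_le (z : ℂ) {x y Y : ℝ} (hy : |y| ≤ Y) :
    ‖Complex.exp (-2 * Complex.I * z * (x + y * Complex.I))‖ ≤
      Real.exp (2 * |z.re| * Y) * Real.exp (2 * |z.im| * |x|) := by
  rw [norm_exp_neg_two_I, ← Real.exp_add, Real.exp_le_exp]
  have h1 : z.im * x ≤ |z.im| * |x| := by rw [← abs_mul]; exact le_abs_self _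
  have h2 : z.re * y ≤ |z.re| * |y| := by rw [← abs_mul]; exact le_abs_self _
  have h3 := mul_le_mul_of_nonneg_left hy (abs_nonneg z.re)
  linarith

lemma integral_shiftKer (hB : 0 < B) {z : ℂ} (hz : |z.im| < (2 * B)⁻¹) :
    (∫ t : ℝ, shiftKer B z (pt B t)) * (1 + Complex.exp (2 * π * B * z)) =
      -2 * π * Complex.I * B * Complex.exp (2 * π * B * z) := by
  have h0 : (B : ℂ) ≠ 0 := by exact_mod_cast hB.ne'
  obtain ⟨d1, d2⟩ := im_mem_dom hz
  have hh := height_pos hB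
  have hhB : height B < π * B := (div_lt_iff₀ hB).1 (height_div_lt hB)
  have hπB : 0 < π * B := mul_pos Real.pi_pos hB
  have hi : Integrable fun t : ℝ => shiftKer B z (pt B t) := by
    have := ((integrable_mul_phiKer hB d1).sub (integrable_mul_phiKer hB d2)).const_mul
      (-Complex.I)
    refine this.congr (Eventually.of_forall fun t => ?_)
    simp only [Pi.sub_apply, shiftKer_pt hB]
    linear_combination (-shiftKer B z (pt B t)) * Complex.I_sq
  have hline : ∀ t : ℝ, (t : ℂ) + ((height B + π * B : ℝ) : ℂ) * Complex.I =
      pt B t + π * B * Complex.I := by intro t; unfold pt; push_cast; ring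
  have e1 : ((π * B : ℝ) : ℂ) * Complex.I / B = π * Complex.I := by push_cast; field_simp
  have key := integral_line_sub_eq_residue (k := shiftKer B z) (A := 0)
    (r := -B * Complex.exp (2 * π * B * z)) (q := π * B) (y₁ := height B)
    (y₂ := height B + π * B) (X := B)
    (g := fun x => 4 * Real.exp (2 * |z.re| * (height B + π * B)) *
      Real.exp (-((B⁻¹ - 2 * |z.im|) * x))) hhB (by linarith) ?_ ?_ ?_ ?_ hi ?_
  · simp only [hline, shiftKer_add hB] at key
    rw [integral_const_mul] at key
    change (∫ t : ℝ, shiftKer B z (pt B t)) - _ = _ at key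
    linear_combination key
  · intro w hw
    refine DifferentiableAt.differentiableWithinAt ?_
    unfold shiftKer
    refine DifferentiableAt.div (by fun_prop) (by fun_prop) ?_
    have him : (w / B).im = w.im / B := by simp
    have hre : (w / B).re = w.re / B := by simp
    rcases eq_or_ne w.re 0 with hr | hr
    · refine sinh_ne_zero_of_im ?_
      rw [him]
      have hne : w.im ≠ π * B := by
        intro h
        apply hw.2
        refine Complex.ext ?_ ?_ <;> simp [hr, h]
      have hw1 : 0 < w.im / B := div_pos (hh.trans_le hw.1.1) hB
      have hw2 : w.im / B < 2 * π := by rw [div_lt_iff₀ hB]; linarith [hw.1.2]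
      have hw3 : w.im / B ≠ π := by
        intro h; rw [div_eq_iff hB.ne'] at h; exact hne h
      rcases lt_or_gt_of_ne hw3 with h | h
      · exact (Real.sin_pos_of_pos_of_lt_pi hw1 h).ne'
      · have := Real.sin_pos_of_pos_of_lt_pi (x := w.im / B - π) (by linarith) (by linarith)
        rw [Real.sin_sub_pi] at this
        linarith
    · refine sinh_ne_zero_of_re ?_
      rw [hre]; exact div_ne_zero hr hB.ne'
  · have hd : HasDerivAt (fun w : ℂ => Complex.sinh (w / B)) (-(B : ℂ)⁻¹)
        (((π * B : ℝ) : ℂ) * Complex.I) := by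
      have h1 : HasDerivAt (fun w : ℂ => w / B) ((B : ℂ)⁻¹) (((π * B : ℝ) : ℂ) * Complex.I) := by
        simpa using (hasDerivAt_id (((π * B : ℝ) : ℂ) * Complex.I)).div_const (B : ℂ)
      refine h1.csinh.congr_deriv ?_
      rw [e1, Complex.cosh_mul_I, Complex.cos_pi]; ring
    have hs := hasDerivAt_iff_tendsto_slope.1 hd
    have hs' := hs.inv₀ (by simpa using h0)
    have hexp : Tendsto (fun w : ℂ => Complex.exp (-2 * Complex.I * z * w))
        (𝓝[≠] (((π * B : ℝ) : ℂ) * Complex.I)) (𝓝 (Complex.exp (2 * π * B * z))) := by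
      have hc : Continuous fun w : ℂ => Complex.exp (-2 * Complex.I * z * w) := by fun_prop
      have := (hc.tendsto (((π * B : ℝ) : ℂ) * Complex.I)).mono_left
        (nhdsWithin_le_nhds (s := {(((π * B : ℝ) : ℂ) * Complex.I)}ᶜ))
      convert this using 3
      push_cast; linear_combination (2 * z * π * B) * Complex.I_sq
    have := hexp.mul hs'
    have er : Complex.exp (2 * π * B * z) * (-(B : ℂ)⁻¹)⁻¹ = -B * Complex.exp (2 * π * B * z) := by
      rw [inv_neg, inv_inv]; ring
    rw [er] at this
    refine this.congr fun w => ?_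
    have e3 : Complex.sinh (((π * B : ℝ) : ℂ) * Complex.I / B) = 0 := by
      rw [e1, Complex.sinh_mul_I, Complex.sin_pi, zero_mul]
    simp only [slope, vsub_eq_sub, e3, shiftKer, smul_eq_mul, mul_inv, inv_inv, zero_div, sub_zero]
    ring
  · refine tendsto_exp_neg_mul_atTop ?_ _
    have e : (2 * B)⁻¹ = B⁻¹ / 2 := by rw [mul_inv]; ring
    linarith
  · intro x y hy hx
    have hx1 : 1 ≤ |x / B| := by rw [abs_div, abs_of_pos hB, le_div_iff₀ hB]; linarith
    have h1 := le_norm_sinh_of_one_le_abs hx1 (y / B)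
    have e4 : ((x / B : ℝ) : ℂ) + ((y / B : ℝ) : ℂ) * Complex.I = (x + y * Complex.I) / B := by
      push_cast; ring
    rw [e4] at h1
    have h2 := norm_exp_neg_two_I_le z (x := x) (y := y) (Y := height B + π * B)
      (by rw [abs_of_pos (hh.trans_le hy.1)]; exact hy.2)
    rw [shiftKer, norm_div, div_le_iff₀ (lt_of_lt_of_le (by positivity) h1)]
    refine h2.trans ?_
    have e5 : |x / B| = B⁻¹ * |x| := by rw [abs_div, abs_of_pos hB]; ring
    calc _ = 4 * Real.exp (2 * |z.re| * (height B + π * B)) *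
          Real.exp (-((B⁻¹ - 2 * |z.im|) * |x|)) * (Real.exp |x / B| / 4) := by
          rw [e5, show 2 * |z.im| * |x| = -((B⁻¹ - 2 * |z.im|) * |x|) + B⁻¹ * |x| by ring,
            Real.exp_add]; ring
      _ ≤ _ := by gcongr
  · simp only [hline, shiftKer_add hB]
    exact hi.const_mul _

lemma dlogPhi_sub (hB : 0 < B) {z : ℂ} (hz : |z.im| < (2 * B)⁻¹) :
    (dlogPhi B (z - Complex.I * B / 2) - dlogPhi B (z + Complex.I * B / 2)) *
      (1 + Complex.exp (2 * π * B * z)) = 2 * π * B * Complex.exp (2 * π * B * z) := by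
  obtain ⟨d1, d2⟩ := im_mem_dom hz
  unfold dlogPhi
  rw [← integral_sub (integrable_mul_phiKer hB d1) (integrable_mul_phiKer hB d2)]
  simp only [shiftKer_pt hB]
  rw [integral_const_mul]
  linear_combination Complex.I * integral_shiftKer hB hz -
    2 * π * B * Complex.exp (2 * π * B * z) * Complex.I_sq

lemma tendsto_logPhi_atBot (hB : 0 < B) {z : ℂ} (hz : z ∈ dom B) :
    Tendsto (fun x : ℝ => logPhi B (z + x)) atBot (𝓝 0) := by
  obtain ⟨C, -, hC⟩ := logPhi_bounds hB hz.out
  have h : Tendsto (fun x : ℝ => C * Real.exp (2 * height B * (z.re + x))) atBot (𝓝 0) := by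
    have h1 : Tendsto (fun x : ℝ => 2 * height B * (z.re + x)) atBot atBot :=
      (tendsto_atBot_add_const_left _ _ tendsto_id).const_mul_atBot
        (by have := height_pos hB; positivity)
    simpa using (Real.tendsto_exp_atBot.comp h1).const_mul C
  refine squeeze_zero_norm (fun x => ?_) h
  have := (hC (z + x) (by simp)).1
  simpa using this

/-- The functional equation of the quantum dilogarithm inside its strip of definition. -/
theorem PhiS_sub_eq (hB : 0 < B) {z : ℂ} (hz : |z.im| < (2 * B)⁻¹) :
    PhiS B (z - Complex.I * B / 2) =
      (1 + Complex.exp (2 * π * B * z)) * PhiS B (z + Complex.I * B / 2) := by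
  set S : Set ℂ := {z | |z.im| < (2 * B)⁻¹} with hS
  have hSo : IsOpen S := isOpen_lt (continuous_abs.comp Complex.continuous_im) continuous_const
  have hSc : Convex ℝ S := by
    have : S = Complex.imCLM ⁻¹' Ioo (-(2 * B)⁻¹) ((2 * B)⁻¹) := by
      ext w; simp [hS, abs_lt]
    rw [this]
    exact (convex_Ioo _ _).is_linear_preimage Complex.imCLM.isLinear
  have hne : ∀ w ∈ S, 1 + Complex.exp (2 * π * B * w) ≠ 0 := by
    intro w hw
    refine one_add_exp_ne_zero ?_
    have e : (2 * π * B * w : ℂ).im = 2 * π * B * w.im := by simp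
    rw [e, abs_mul, abs_of_pos (by positivity)]
    have := mul_lt_mul_of_pos_left hw.out (by positivity : 0 < 2 * π * B)
    refine this.trans_eq (by field_simp)
  set G : ℂ → ℂ := fun w => Complex.exp (logPhi B (w - Complex.I * B / 2) -
    logPhi B (w + Complex.I * B / 2)) / (1 + Complex.exp (2 * π * B * w)) with hG
  have hGd : ∀ w ∈ S, HasDerivAt G 0 w := by
    intro w hw
    obtain ⟨d1, d2⟩ := im_mem_dom hw
    have h1 : HasDerivAt (fun w => logPhi B (w - Complex.I * B / 2)) _ w :=
      (hasDerivAt_logPhi hB d1).comp_sub_const w _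
    have h2 : HasDerivAt (fun w => logPhi B (w + Complex.I * B / 2)) _ w :=
      (hasDerivAt_logPhi hB d2).comp_add_const w _
    have h3 : HasDerivAt (fun w : ℂ => 2 * π * B * w) (2 * π * B) w := by
      simpa using (hasDerivAt_id w).const_mul (2 * π * B : ℂ)
    refine ((h1.sub h2).cexp.div (h3.cexp.const_add 1) (hne w hw)).congr_deriv ?_
    rw [div_eq_zero_iff]; left
    simp only [Pi.sub_apply]
    linear_combination Complex.exp (logPhi B (w - Complex.I * B / 2) -
      logPhi B (w + Complex.I * B / 2)) * dlogPhi_sub hB hw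
  have hconst : ∀ x : ℝ, G (z + x) = G z := fun x =>
    hSo.is_const_of_deriv_eq_zero hSc.isPreconnected
      (fun w hw => (hGd w hw).differentiableAt.differentiableWithinAt)
      (fun w hw => (hGd w hw).deriv) (by simpa [hS] using hz) hz
  have hlim : Tendsto (fun x : ℝ => G (z + x)) atBot (𝓝 1) := by
    obtain ⟨d1, d2⟩ := im_mem_dom hz
    have h1 := tendsto_logPhi_atBot hB d1
    have h2 := tendsto_logPhi_atBot hB d2
    have h3 : Tendsto (fun x : ℝ => Complex.exp (2 * π * B * (z + x))) atBot (𝓝 0) := by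
      rw [Complex.tendsto_exp_nhds_zero_iff]
      have : ∀ x : ℝ, (2 * π * B * (z + x) : ℂ).re = 2 * π * B * (z.re + x) := by
        intro x; simp
      simp only [this]
      exact (tendsto_atBot_add_const_left _ _ tendsto_id).const_mul_atBot (by positivity)
    have h4 := (h1.sub h2).cexp.div (h3.const_add 1) (by simp)
    simp only [sub_zero, Complex.exp_zero, add_zero, div_one] at h4
    refine h4.congr fun x => ?_
    simp only [hG, Pi.div_apply]
    congr 4 <;> ring_nf
  simp only [hconst] at hlim
  have h1 : G z = 1 := tendsto_nhds_unique tendsto_const_nhds hlim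
  rw [hG] at h1
  simp only at h1
  rw [div_eq_one_iff_eq (hne z hz), Complex.exp_sub, div_eq_iff (Complex.exp_ne_zero _)] at h1
  rw [PhiS_eq, PhiS_eq, h1]

end

section

variable {B : ℝ}

lemma tendsto_cos_sub_one_div_sq : Tendsto (fun x : ℂ => (Complex.cos x - 1) / x ^ 2) (𝓝[≠] 0)
    (𝓝 (-1 / 2)) := by
  have h := (Complex.exp_sub_sum_range_succ_isLittleO_pow 2).tendsto_div_nhds_zero
  have hp : Tendsto (fun x : ℂ => x * Complex.I) (𝓝 0) (𝓝 0) :=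
    Continuous.tendsto' (by fun_prop) _ _ (by simp)
  have hm : Tendsto (fun x : ℂ => -x * Complex.I) (𝓝 0) (𝓝 0) :=
    Continuous.tendsto' (by fun_prop) _ _ (by simp)
  have h1 := ((((h.comp hp).add (h.comp hm)).const_mul (-1 / 2 : ℂ)).const_add
    (-1 / 2 : ℂ)).mono_left (nhdsWithin_le_nhds (s := {0}ᶜ))
  simp only [add_zero, mul_zero] at h1
  refine h1.congr' ?_
  filter_upwards [self_mem_nhdsWithin] with x hx
  have hx : x ≠ 0 := hx
  have hI := Complex.I_ne_zero
  simp only [Function.comp, Finset.sum_range_succ, Finset.sum_range_zero, Complex.cos, mul_pow,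
    Complex.I_sq, neg_sq]
  norm_num [Nat.factorial]
  field_simp
  ring

lemma tendsto_sinh_sub_div_cube : Tendsto (fun x : ℂ => (Complex.sinh x - x) / x ^ 3) (𝓝[≠] 0)
    (𝓝 (1 / 6)) := by
  have h := (Complex.exp_sub_sum_range_succ_isLittleO_pow 3).tendsto_div_nhds_zero
  have hm : Tendsto (fun x : ℂ => -x) (𝓝 0) (𝓝 0) :=
    Continuous.tendsto' (by fun_prop) _ _ (by simp)
  have h1 := (((h.add (h.comp hm)).const_mul (1 / 2 : ℂ)).const_add
    (1 / 6 : ℂ)).mono_left (nhdsWithin_le_nhds (s := {0}ᶜ))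
  simp only [add_zero, mul_zero] at h1
  refine h1.congr' ?_
  filter_upwards [self_mem_nhdsWithin] with x hx
  have hx : x ≠ 0 := hx
  simp only [Function.comp, Finset.sum_range_succ, Finset.sum_range_zero, Complex.sinh]
  norm_num [Nat.factorial]
  field_simp
  ring

lemma tendsto_const_mul_nhdsNE {p : ℂ} (hp : p ≠ 0) :
    Tendsto (fun w : ℂ => p * w) (𝓝[≠] 0) (𝓝[≠] 0) := by
  refine tendsto_nhdsWithin_iff.2 ⟨?_, ?_⟩
  · exact (Continuous.tendsto' (by fun_prop) _ _ (by simp)).mono_left nhdsWithin_le_nhds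
  · filter_upwards [self_mem_nhdsWithin] with w hw
    exact mul_ne_zero hp hw

lemma tendsto_sinh_div_sub_one {p : ℂ} (hp : p ≠ 0) :
    Tendsto (fun w : ℂ => (Complex.sinh (p * w) / (p * w) - 1) / w ^ 2) (𝓝[≠] 0)
      (𝓝 (p ^ 2 / 6)) := by
  have := (tendsto_sinh_sub_div_cube.comp (tendsto_const_mul_nhdsNE hp)).const_mul (p ^ 2)
  rw [mul_one_div] at this
  refine this.congr' ?_
  filter_upwards [self_mem_nhdsWithin] with w hw
  have hw : w ≠ 0 := hw
  simp only [Function.comp]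
  field_simp

lemma tendsto_sinh_div {p : ℂ} (hp : p ≠ 0) :
    Tendsto (fun w : ℂ => Complex.sinh (p * w) / (p * w)) (𝓝[≠] 0) (𝓝 1) := by
  have h2 : Tendsto (fun w : ℂ => w ^ 2) (𝓝[≠] 0) (𝓝 0) :=
    (Continuous.tendsto' (by fun_prop) _ _ (by simp)).mono_left nhdsWithin_le_nhds
  have := ((tendsto_sinh_div_sub_one hp).mul h2).const_add 1
  rw [mul_zero, add_zero] at this
  refine this.congr' ?_
  filter_upwards [self_mem_nhdsWithin] with w hw
  have hw : w ≠ 0 := hw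
  field_simp
  ring

lemma tendsto_cos_mul_sub_one (p : ℂ) :
    Tendsto (fun w : ℂ => (Complex.cos (p * w) - 1) / w ^ 2) (𝓝[≠] 0) (𝓝 (-p ^ 2 / 2)) := by
  rcases eq_or_ne p 0 with rfl | hp
  · simp
  have := (tendsto_cos_sub_one_div_sq.comp (tendsto_const_mul_nhdsNE hp)).const_mul (p ^ 2)
  rw [show p ^ 2 * (-1 / 2) = -p ^ 2 / 2 by ring] at this
  refine this.congr' ?_
  filter_upwards [self_mem_nhdsWithin] with w hw
  have hw : w ≠ 0 := hw
  simp only [Function.comp]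
  field_simp

/-- The kernel of `logPhi z + logPhi (-z)`. -/
def cosKer (B : ℝ) (z w : ℂ) : ℂ :=
  Complex.cos (2 * z * w) / (2 * Complex.sinh (w * B) * Complex.sinh (w / B) * w)

lemma phiKer_add_phiKer_neg (B : ℝ) (z w : ℂ) :
    phiKer B z w + phiKer B (-z) w = cosKer B z w := by
  unfold phiKer cosKer
  have : Complex.cos (2 * z * w) = (Complex.exp (-2 * Complex.I * z * w) +
      Complex.exp (-2 * Complex.I * -z * w)) / 2 := by
    rw [Complex.cos, add_comm]; congr 3 <;> ring
  rw [this]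
  ring

lemma cosKer_neg (B : ℝ) (z w : ℂ) : cosKer B z (-w) = -cosKer B z w := by
  unfold cosKer
  rw [mul_neg, Complex.cos_neg, neg_mul, Complex.sinh_neg, neg_div, Complex.sinh_neg]
  rw [show 2 * -Complex.sinh (w * B) * -Complex.sinh (w / B) * -w =
    -(2 * Complex.sinh (w * B) * Complex.sinh (w / B) * w) by ring, div_neg]

lemma tendsto_cosKer (hB : 0 < B) (z : ℂ) :
    Tendsto (fun w : ℂ => w * cosKer B z w - (1 / 2) / w ^ 2) (𝓝[≠] 0)
      (𝓝 (-z ^ 2 - (B ^ 2 + (B : ℂ)⁻¹ ^ 2) / 12)) := by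
  have h0 : (B : ℂ) ≠ 0 := by exact_mod_cast hB.ne'
  have h0' : (B : ℂ)⁻¹ ≠ 0 := inv_ne_zero h0
  have hc := tendsto_cos_mul_sub_one (2 * z)
  have a1 := tendsto_sinh_div_sub_one h0
  have a2 := tendsto_sinh_div_sub_one h0'
  have b1 := tendsto_sinh_div h0
  have b2 := tendsto_sinh_div h0'
  have key := (hc.sub ((a1.mul b2).add a2)).div ((b1.mul b2).const_mul 2) (by simp)
  have e : (-(2 * z) ^ 2 / 2 - ((B : ℂ) ^ 2 / 6 * 1 + (B : ℂ)⁻¹ ^ 2 / 6)) / (2 * (1 * 1)) =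
    -z ^ 2 - (B ^ 2 + (B : ℂ)⁻¹ ^ 2) / 12 := by ring
  rw [e] at key
  refine key.congr' ?_
  have n1 := b1.eventually_ne one_ne_zero
  have n2 := b2.eventually_ne one_ne_zero
  filter_upwards [self_mem_nhdsWithin, n1, n2] with w hw hs1 hs2
  have hw : w ≠ 0 := hw
  have hs1 : Complex.sinh (B * w) ≠ 0 := fun h => hs1 (by simp [h])
  have hs2 : Complex.sinh ((B : ℂ)⁻¹ * w) ≠ 0 := fun h => hs2 (by simp [h])
  rw [← div_eq_inv_mul] at hs2
  simp only [Pi.div_apply, cosKer, ← div_eq_inv_mul, mul_comm w (B : ℂ)]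
  generalize Complex.sinh (B * w) = p at hs1 ⊢
  generalize Complex.sinh (w / B) = q at hs2 ⊢
  field_simp
  ring

lemma integral_cosKer (hB : 0 < B) {z : ℂ} (hz : z ∈ dom B) :
    logPhi B z + logPhi B (-z) = ∫ t : ℝ, cosKer B z (pt B t) := by
  unfold logPhi
  rw [← integral_add (integrable_phiKer hB hz)
    (integrable_phiKer hB (by simpa [dom] using hz))]
  simp only [phiKer_add_phiKer_neg]

/-- The inversion relation, at the level of logarithms. -/
theorem logPhi_add_logPhi_neg (hB : 0 < B) {z : ℂ} (hz : z ∈ dom B) :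
    logPhi B z + logPhi B (-z) =
      Complex.I * π * z ^ 2 + Complex.I * π * (B ^ 2 + (B : ℂ)⁻¹ ^ 2) / 12 := by
  have h0 : (B : ℂ) ≠ 0 := by exact_mod_cast hB.ne'
  have hh := height_pos hB
  have hneg : ∀ t : ℝ, cosKer B z (t + ((-height B : ℝ) : ℂ) * Complex.I) =
      -cosKer B z (pt B (-t)) := by
    intro t
    rw [← cosKer_neg]; congr 1; unfold pt; push_cast; ring
  have hi : Integrable fun t : ℝ => cosKer B z (pt B t) := by
    refine ((integrable_phiKer hB hz).add
      (integrable_phiKer hB (z := -z) (by simpa [dom] using hz))).congr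
      (Eventually.of_forall fun t => ?_)
    simp only [Pi.add_apply, phiKer_add_phiKer_neg]
  have key := integral_line_sub_eq_residue (k := cosKer B z) (A := 1 / 2)
    (r := -z ^ 2 - (B ^ 2 + (B : ℂ)⁻¹ ^ 2) / 12) (q := 0) (y₁ := -height B)
    (y₂ := height B) (X := 1 + B + B⁻¹)
    (g := fun x => 8 * Real.exp (2 * |z.re| * height B) *
      Real.exp (-((2 * hw B - 2 * |z.im|) * x))) (by linarith) hh ?_ ?_ ?_ ?_ ?_ hi
  · simp only [hneg] at key
    rw [integral_neg, integral_neg_eq_self (fun t => cosKer B z (pt B t))] at key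
    rw [integral_cosKer hB hz]
    change -_ - (∫ t : ℝ, cosKer B z (pt B t)) = _ at key
    linear_combination (-1 / 2) * key
  · intro w hw
    refine DifferentiableAt.differentiableWithinAt ?_
    have hw0 : w ≠ 0 := fun h => hw.2 (by simp [h])
    have hm : (w * B).im = w.im * B := by simp
    have hd : (w / B).im = w.im / B := by simp
    have hmr : (w * B).re = w.re * B := by simp
    have hdr : (w / B).re = w.re / B := by simp
    have hBh := height_mul_lt hB
    have hBd := height_div_lt hB
    have n1 : Complex.sinh (w * B) ≠ 0 := by
      rcases eq_or_ne w.re 0 with hr | hr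
      · have him : w.im ≠ 0 := fun h => hw0 (Complex.ext hr h)
        refine sinh_ne_zero_of_im ?_
        rw [hm, Ne, Real.sin_eq_zero_iff_of_lt_of_lt]
        · exact mul_ne_zero him hB.ne'
        · nlinarith [hw.1.1]
        · nlinarith [hw.1.2]
      · exact sinh_ne_zero_of_re (by rw [hmr]; exact mul_ne_zero hr hB.ne')
    have n2 : Complex.sinh (w / B) ≠ 0 := by
      rcases eq_or_ne w.re 0 with hr | hr
      · have him : w.im ≠ 0 := fun h => hw0 (Complex.ext hr h)
        refine sinh_ne_zero_of_im ?_
        rw [div_lt_iff₀ hB] at hBd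
        rw [hd, Ne, Real.sin_eq_zero_iff_of_lt_of_lt]
        · exact div_ne_zero him hB.ne'
        · rw [lt_div_iff₀ hB]; linarith [hw.1.1]
        · rw [div_lt_iff₀ hB]; linarith [hw.1.2]
      · exact sinh_ne_zero_of_re (by rw [hdr]; exact div_ne_zero hr hB.ne')
    unfold cosKer
    exact DifferentiableAt.div (by fun_prop) (by fun_prop)
      (mul_ne_zero (mul_ne_zero (mul_ne_zero two_ne_zero n1) n2) hw0)
  · simpa using tendsto_cosKer hB z
  · exact tendsto_exp_neg_mul_atTop (by linarith [hz.out]) _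
  · intro x y hy hx
    have hBi : 0 < B⁻¹ := inv_pos.2 hB
    have hx0 : 1 ≤ |x| := by linarith
    have hx1 : 1 ≤ |x * B| := by
      rw [abs_mul, abs_of_pos hB, ← div_le_iff₀ hB, one_div]; linarith
    have hx2 : 1 ≤ |x / B| := by rw [abs_div, abs_of_pos hB, le_div_iff₀ hB]; linarith
    have h1 := le_norm_sinh_of_one_le_abs hx1 (y * B)
    have h2 := le_norm_sinh_of_one_le_abs hx2 (y / B)
    have e1 : ((x * B : ℝ) : ℂ) + ((y * B : ℝ) : ℂ) * Complex.I = (x + y * Complex.I) * B := by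
      push_cast; ring
    have e2 : ((x / B : ℝ) : ℂ) + ((y / B : ℝ) : ℂ) * Complex.I = (x + y * Complex.I) / B := by
      push_cast; ring
    rw [e1] at h1
    rw [e2] at h2
    have hw1 : 1 ≤ ‖(x + y * Complex.I : ℂ)‖ :=
      hx0.trans (by simpa using Complex.abs_re_le_norm (x + y * Complex.I : ℂ))
    have hy' : |y| ≤ height B := abs_le.2 hy
    have c1 := norm_exp_neg_two_I_le z (x := x) hy'
    have c2 := norm_exp_neg_two_I_le (-z) (x := x) hy'
    rw [Complex.neg_re, Complex.neg_im, abs_neg, abs_neg] at c2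
    set w : ℂ := x + y * Complex.I
    have hcos : ‖Complex.cos (2 * z * w)‖ ≤
        Real.exp (2 * |z.re| * height B) * Real.exp (2 * |z.im| * |x|) := by
      have : Complex.cos (2 * z * w) = (Complex.exp (-2 * Complex.I * z * w) +
          Complex.exp (-2 * Complex.I * -z * w)) / 2 := by
        rw [Complex.cos, add_comm]; congr 3 <;> ring
      rw [this, norm_div, Complex.norm_ofNat, div_le_iff₀ two_pos]
      exact (norm_add_le _ _).trans (by linarith)
    have hden : 2 * (Real.exp |x * B| / 4) * (Real.exp |x / B| / 4) * 1 ≤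
        ‖2 * Complex.sinh (w * B) * Complex.sinh (w / B) * w‖ := by
      rw [norm_mul, norm_mul, norm_mul, Complex.norm_ofNat]
      gcongr
    rw [cosKer, norm_div, div_le_iff₀ (lt_of_lt_of_le (by positivity) hden)]
    refine hcos.trans ?_
    have e5 : Real.exp (2 * |z.im| * |x|) = Real.exp (-((2 * hw B - 2 * |z.im|) * |x|)) *
        (Real.exp |x * B| * Real.exp |x / B|) := by
      rw [← Real.exp_add, ← Real.exp_add, abs_mul, abs_div, abs_of_pos hB]; congr 1; unfold hw
      field_simp; ring
    calc _ = 8 * Real.exp (2 * |z.re| * height B) *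
          Real.exp (-((2 * hw B - 2 * |z.im|) * |x|)) *
          (2 * (Real.exp |x * B| / 4) * (Real.exp |x / B| / 4) * 1) := by
          rw [e5]; ring
      _ ≤ _ := by gcongr
  · simp only [hneg]
    exact (hi.comp_neg).neg

lemma star_phiKer (B y : ℝ) (t : ℝ) :
    (starRingEnd ℂ) (phiKer B (y * Complex.I) (pt B t)) =
      -phiKer B (-(y * Complex.I)) (pt B (-t)) := by
  have e : (starRingEnd ℂ) (pt B t) = -pt B (-t) := by
    unfold pt; simp; ring
  unfold phiKer
  rw [map_div₀, map_mul, map_mul, map_mul, ← Complex.exp_conj, ← Complex.sinh_conj,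
    ← Complex.sinh_conj]
  simp only [map_mul, map_div₀, map_neg, Complex.conj_ofReal, Complex.conj_I, e, map_ofNat]
  generalize pt B (-t) = w
  rw [neg_mul w, Complex.sinh_neg, neg_div, Complex.sinh_neg]
  rw [show 4 * -Complex.sinh (w * B) * -Complex.sinh (w / B) * -w =
    -(4 * Complex.sinh (w * B) * Complex.sinh (w / B) * w) by ring, div_neg]
  congr 3
  ring

lemma star_logPhi (B y : ℝ) :
    (starRingEnd ℂ) (logPhi B (y * Complex.I)) = -logPhi B (-(y * Complex.I)) := by
  unfold logPhi
  rw [← integral_conj]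
  simp only [star_phiKer]
  rw [integral_neg, integral_neg_eq_self (fun t => phiKer B (-(y * Complex.I)) (pt B t))]

lemma differentiableAt_PhiS (hB : 0 < B) {z : ℂ} (hz : z ∈ dom B) :
    DifferentiableAt ℂ (PhiS B) z := by
  have : PhiS B = fun z => Complex.exp (logPhi B z) := funext (PhiS_eq B)
  rw [this]
  exact (hasDerivAt_logPhi hB hz).differentiableAt.cexp

lemma PhiS_shift_comparison (hB : 0 < B) {η : ℝ} (h0 : 0 < η) (h1 : η < B) (h2 : η < B⁻¹) :
    PhiS B (((B⁻¹ - B) / 2 - η : ℝ) * Complex.I) *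
        (1 - Complex.exp (-2 * π * Complex.I * η * (B : ℂ)⁻¹)) =
      PhiS B ((-((B⁻¹ - B) / 2) - η : ℝ) * Complex.I) *
        (1 - Complex.exp (-2 * π * Complex.I * η * B)) := by
  have hc : (B : ℂ) ≠ 0 := by exact_mod_cast hB.ne'
  have hBi : 0 < B⁻¹ := inv_pos.2 hB
  have a := PhiS_sub_eq hB (z := ((B⁻¹ / 2 - η : ℝ) : ℂ) * Complex.I) (by
    have e : (2 * B)⁻¹ = B⁻¹ / 2 := by rw [mul_inv]; ring
    rw [e, abs_lt]; simp only [Complex.im_ofReal_mul, Complex.I_im, mul_one]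
    constructor <;> linarith)
  have b := PhiS_sub_eq hBi (z := ((B / 2 - η : ℝ) : ℂ) * Complex.I) (by
    have e : (2 * B⁻¹)⁻¹ = B / 2 := by rw [mul_inv, inv_inv]; ring
    rw [e, abs_lt]; simp only [Complex.im_ofReal_mul, Complex.I_im, mul_one]
    constructor <;> linarith)
  simp only [PhiS_inv] at b
  have ea : Complex.exp (2 * π * B * (((B⁻¹ / 2 - η : ℝ) : ℂ) * Complex.I)) =
      -Complex.exp (-2 * π * Complex.I * η * B) := by
    rw [show (2 * π * B * (((B⁻¹ / 2 - η : ℝ) : ℂ) * Complex.I) : ℂ) =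
      π * Complex.I + -2 * π * Complex.I * η * B by push_cast; field_simp; ring,
      Complex.exp_add, Complex.exp_pi_mul_I]; ring
  have eb : Complex.exp (2 * π * (B⁻¹ : ℝ) * (((B / 2 - η : ℝ) : ℂ) * Complex.I)) =
      -Complex.exp (-2 * π * Complex.I * η * (B : ℂ)⁻¹) := by
    rw [show (2 * π * (B⁻¹ : ℝ) * (((B / 2 - η : ℝ) : ℂ) * Complex.I) : ℂ) =
      π * Complex.I + -2 * π * Complex.I * η * (B : ℂ)⁻¹ by push_cast; field_simp; ring,
      Complex.exp_add, Complex.exp_pi_mul_I]; ring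
  rw [ea] at a
  rw [eb] at b
  have e1 : (((B⁻¹ / 2 - η : ℝ) : ℂ) * Complex.I - Complex.I * B / 2) =
    (((B⁻¹ - B) / 2 - η : ℝ) : ℂ) * Complex.I := by push_cast; ring
  have e2 : (((B / 2 - η : ℝ) : ℂ) * Complex.I - Complex.I * (B⁻¹ : ℝ) / 2) =
    ((-((B⁻¹ - B) / 2) - η : ℝ) : ℂ) * Complex.I := by push_cast; ring
  have e3 : (((B / 2 - η : ℝ) : ℂ) * Complex.I + Complex.I * (B⁻¹ : ℝ) / 2) =
    ((B⁻¹ / 2 - η : ℝ) : ℂ) * Complex.I + Complex.I * B / 2 := by push_cast; ring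
  rw [e1] at a
  rw [e2, e3] at b
  rw [a, b]
  ring

lemma tendsto_one_sub_exp_div (p : ℂ) :
    Tendsto (fun η : ℝ => (1 - Complex.exp (-2 * π * Complex.I * η * p)) / η) (𝓝[>] 0)
      (𝓝 (2 * π * Complex.I * p)) := by
  have h1 : HasDerivAt (fun η : ℝ => 1 - Complex.exp (-2 * π * Complex.I * η * p))
      (2 * π * Complex.I * p) 0 := by
    have h2 : HasDerivAt (fun η : ℝ => -2 * π * Complex.I * (η : ℂ) * p)
        (-2 * π * Complex.I * p) 0 := by
      simpa using ((Complex.ofRealCLM.hasDerivAt (x := 0)).const_mul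
        (-2 * π * Complex.I : ℂ)).mul_const p
    refine (h2.cexp.const_sub 1).congr_deriv ?_
    simp
  have := (hasDerivAt_iff_tendsto_slope.1 h1).mono_left
    (nhdsWithin_mono 0 (fun x (hx : 0 < x) => hx.ne'))
  refine this.congr fun η => ?_
  simp [slope, div_eq_inv_mul]

lemma mem_dom_mul_I {y : ℝ} (hy : |y| < hw B) : (y : ℂ) * Complex.I ∈ dom B := by
  simpa [dom] using hy

lemma abs_sub_lt_hw (hB : 0 < B) : |(B⁻¹ - B) / 2| < hw B := by
  have : 0 < B⁻¹ := inv_pos.2 hB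
  rw [abs_lt]; unfold hw; constructor <;> linarith

lemma PhiS_ratio (hB : 0 < B) :
    PhiS B (((B⁻¹ - B) / 2 : ℝ) * Complex.I) =
      B ^ 2 * PhiS B (-(((B⁻¹ - B) / 2 : ℝ) * Complex.I)) := by
  have hc : (B : ℂ) ≠ 0 := by exact_mod_cast hB.ne'
  have hBi : 0 < B⁻¹ := inv_pos.2 hB
  have hcont : ∀ y : ℝ, |y| < hw B →
      Tendsto (fun η : ℝ => PhiS B ((y - η : ℝ) * Complex.I)) (𝓝[>] 0)
        (𝓝 (PhiS B (y * Complex.I))) := by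
    intro y hy
    refine (differentiableAt_PhiS hB (mem_dom_mul_I hy)).continuousAt.tendsto.comp ?_
    exact (Continuous.tendsto' (by fun_prop) _ _ (by simp)).mono_left nhdsWithin_le_nhds
  have h1 := (hcont _ (abs_sub_lt_hw hB)).mul (tendsto_one_sub_exp_div (B⁻¹ : ℂ))
  have h2 := (hcont (-((B⁻¹ - B) / 2)) (by rw [abs_neg]; exact abs_sub_lt_hw hB)).mul
    (tendsto_one_sub_exp_div (B : ℂ))
  have h3 := tendsto_nhds_unique (h1.congr' ?_) h2
  · have hπ : (π : ℂ) ≠ 0 := by exact_mod_cast Real.pi_ne_zero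
    have hI := Complex.I_ne_zero
    rw [Complex.ofReal_neg, neg_mul] at h3
    generalize PhiS B (((B⁻¹ - B) / 2 : ℝ) * Complex.I) = p at h3 ⊢
    generalize PhiS B (-(((B⁻¹ - B) / 2 : ℝ) * Complex.I)) = q at h3 ⊢
    field_simp at h3
    linear_combination h3
  · filter_upwards [self_mem_nhdsWithin, nhdsWithin_le_nhds (Iio_mem_nhds hB),
      nhdsWithin_le_nhds (Iio_mem_nhds hBi)] with η h0 h1 h2
    rw [mul_div_assoc', mul_div_assoc', PhiS_shift_comparison hB h0 h1 h2]

/-- A special value of the quantum dilogarithm. -/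
theorem PhiS_special (hB : 0 < B) :
    PhiS B (-(((B⁻¹ - B) / 2 : ℝ) * Complex.I)) =
      (B : ℂ)⁻¹ * Complex.exp (Complex.I * π * (1 / 4 - (B ^ 2 + (B : ℂ)⁻¹ ^ 2) / 12)) := by
  have hc : (B : ℂ) ≠ 0 := by exact_mod_cast hB.ne'
  have hr := PhiS_ratio hB
  have hs := star_logPhi B ((B⁻¹ - B) / 2)
  have hinv := logPhi_add_logPhi_neg hB (mem_dom_mul_I (abs_sub_lt_hw hB))
  rw [PhiS_eq, PhiS_eq] at hr
  rw [PhiS_eq]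
  set z₀ : ℂ := (((B⁻¹ - B) / 2 : ℝ) : ℂ) * Complex.I with hz₀
  have h1 : Complex.exp (logPhi B z₀ - logPhi B (-z₀)) = B ^ 2 := by
    rw [Complex.exp_sub, hr, mul_div_assoc, div_self (Complex.exp_ne_zero _), mul_one]
  have h2 : logPhi B z₀ - logPhi B (-z₀) = ((2 * (logPhi B z₀).re : ℝ) : ℂ) := by
    rw [sub_eq_add_neg, ← hs, Complex.add_conj]
  rw [h2, ← Complex.ofReal_exp, ← Complex.ofReal_pow, Complex.ofReal_inj] at h1
  have h3 : 2 * (logPhi B z₀).re = 2 * Real.log B := by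
    rw [← Real.log_exp (2 * (logPhi B z₀).re), h1, Real.log_pow]; norm_num
  have h4 : logPhi B (-z₀) = -(Real.log B : ℂ) +
      Complex.I * π * (1 / 4 - (B ^ 2 + (B : ℂ)⁻¹ ^ 2) / 12) := by
    have e : z₀ ^ 2 = -((B : ℂ)⁻¹ ^ 2 + B ^ 2 - 2) / 4 := by
      rw [hz₀, mul_pow, Complex.I_sq]; push_cast; field_simp; ring
    rw [h3] at h2
    push_cast at h2
    rw [e] at hinv
    linear_combination (1 / 2) * hinv - (1 / 2) * h2
  rw [h4, Complex.exp_add, Complex.exp_neg, ← Complex.ofReal_exp, Real.exp_log hB]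

end

section

variable {B : ℝ}

/-- The reciprocal of the quantum dilogarithm. -/
def rPhi (B : ℝ) (z : ℂ) : ℂ := Complex.exp (-logPhi B z)

/-- The derivative of `rPhi`. -/
def drPhi (B : ℝ) (z : ℂ) : ℂ := -dlogPhi B z * rPhi B z

lemma rPhi_eq (B : ℝ) (z : ℂ) : rPhi B z = (PhiS B z)⁻¹ := by
  rw [rPhi, PhiS_eq, Complex.exp_neg]

lemma hasDerivAt_rPhi (hB : 0 < B) {z : ℂ} (hz : z ∈ dom B) :
    HasDerivAt (rPhi B) (drPhi B z) z := by
  refine (hasDerivAt_logPhi hB hz).neg.cexp.congr_deriv ?_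
  unfold drPhi rPhi; rw [mul_comm]; rfl

lemma differentiableOn_drPhi (hB : 0 < B) : DifferentiableOn ℂ (drPhi B) (dom B) := by
  have h1 : DifferentiableOn ℂ (rPhi B) (dom B) := fun z hz =>
    (hasDerivAt_rPhi hB hz).differentiableAt.differentiableWithinAt
  exact (h1.deriv isOpen_dom).congr fun z hz => (hasDerivAt_rPhi hB hz).deriv.symm

lemma neg_mem_dom {z : ℂ} (hz : z ∈ dom B) : -z ∈ dom B := by simpa [dom] using hz

lemma dlogPhi_sub_dlogPhi_neg (hB : 0 < B) {z : ℂ} (hz : z ∈ dom B) :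
    dlogPhi B z - dlogPhi B (-z) = 2 * π * Complex.I * z := by
  have h1 := (hasDerivAt_logPhi hB hz)
  have h2 : HasDerivAt (fun z => logPhi B (-z)) (-dlogPhi B (-z)) z := by
    have := (hasDerivAt_logPhi hB (neg_mem_dom hz)).comp z (hasDerivAt_neg z)
    simpa [Function.comp_def] using this
  have h3 : HasDerivAt (fun z : ℂ => Complex.I * π * z ^ 2 +
      Complex.I * π * (B ^ 2 + (B : ℂ)⁻¹ ^ 2) / 12) (2 * π * Complex.I * z) z := by
    have := (((hasDerivAt_id z).pow 2).const_mul (Complex.I * π)).add_const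
      (Complex.I * π * (B ^ 2 + (B : ℂ)⁻¹ ^ 2) / 12)
    refine (this.congr_deriv ?_)
    simp; ring
  have h4 := (h1.add h2).congr_of_eventuallyEq (f₁ := fun z : ℂ => Complex.I * π * z ^ 2 +
      Complex.I * π * (B ^ 2 + (B : ℂ)⁻¹ ^ 2) / 12) (by
    filter_upwards [isOpen_dom.mem_nhds hz] with w hw
    exact (logPhi_add_logPhi_neg hB hw).symm)
  rw [sub_eq_add_neg, ← h3.unique h4]

/-- Bounds for `logPhi` and `dlogPhi` in the left half of a closed substrip. -/
lemma logPhi_bounds_left (hB : 0 < B) {y : ℝ} (hy : y < hw B) : ∃ C, 0 ≤ C ∧ ∀ z : ℂ, |z.im| ≤ y →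
    z.re ≤ 0 → ‖logPhi B z‖ ≤ C ∧ ‖dlogPhi B z‖ ≤ C * Real.exp (2 * height B * z.re) := by
  obtain ⟨C, hC0, hC⟩ := logPhi_bounds hB hy
  refine ⟨C, hC0, fun z hz hr => ⟨(hC z hz).1.trans ?_, (hC z hz).2⟩⟩
  refine mul_le_of_le_one_right hC0 (Real.exp_le_one_iff.2 ?_)
  nlinarith [height_pos hB]

lemma norm_exp_sq (z : ℂ) (p : ℝ) :
    ‖Complex.exp (p * π * Complex.I * z ^ 2)‖ = Real.exp (-p * (2 * π * z.re * z.im)) := by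
  rw [Complex.norm_exp]; congr 1
  simp [pow_two]; ring

lemma norm_exp_inversion (hB : 0 < B) {z : ℂ} (hz : z ∈ dom B) :
    ‖Complex.exp (logPhi B z)‖ =
      ‖Complex.exp (-logPhi B (-z))‖ * Real.exp (-(2 * π * z.re * z.im)) := by
  have h := logPhi_add_logPhi_neg hB hz
  have e : logPhi B z = -logPhi B (-z) + ((1 : ℝ) * π * Complex.I * z ^ 2 +
      ((π * (B ^ 2 + B⁻¹ ^ 2) / 12 : ℝ) : ℂ) * Complex.I) := by
    push_cast; linear_combination h
  rw [e, Complex.exp_add, Complex.exp_add, norm_mul, norm_mul, Complex.norm_exp_ofReal_mul_I,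
    norm_exp_sq, mul_one]
  norm_num

lemma norm_exp_le_of_norm_le {w : ℂ} {C : ℝ} (h : ‖w‖ ≤ C) : ‖Complex.exp w‖ ≤ Real.exp C := by
  rw [Complex.norm_exp, Real.exp_le_exp]
  exact (Complex.re_le_norm w).trans h

lemma PhiS_bounds (hB : 0 < B) {y : ℝ} (hy : y < hw B) : ∃ C, 0 ≤ C ∧ ∀ z : ℂ, |z.im| ≤ y →
    (z.re ≤ 0 → ‖PhiS B z‖ ≤ C) ∧
    (0 ≤ z.re → ‖PhiS B z‖ ≤ C * Real.exp (-(2 * π * z.re * z.im))) := by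
  obtain ⟨C, hC0, hC⟩ := logPhi_bounds_left hB hy
  refine ⟨Real.exp C, (Real.exp_pos _).le, fun z hz => ⟨fun hr => ?_, fun hr => ?_⟩⟩
  · rw [PhiS_eq]
    exact norm_exp_le_of_norm_le (hC z hz hr).1
  · rw [PhiS_eq, norm_exp_inversion hB (hz.trans_lt hy)]
    refine mul_le_mul_of_nonneg_right (norm_exp_le_of_norm_le ?_) (Real.exp_pos _).le
    rw [norm_neg]
    exact (hC (-z) (by simpa using hz) (by simpa using hr)).1

lemma rPhi_bounds (hB : 0 < B) {y : ℝ} (hy : y < hw B) : ∃ C, 0 ≤ C ∧ ∀ z : ℂ, |z.im| ≤ y →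
    (z.re ≤ 0 → ‖rPhi B z‖ ≤ C) ∧
    (0 ≤ z.re → ‖rPhi B z‖ ≤ C * Real.exp (2 * π * z.re * z.im)) := by
  obtain ⟨C, hC0, hC⟩ := logPhi_bounds_left hB hy
  refine ⟨Real.exp C, (Real.exp_pos _).le, fun z hz => ⟨fun hr => ?_, fun hr => ?_⟩⟩
  · rw [rPhi]
    exact norm_exp_le_of_norm_le (by rw [norm_neg]; exact (hC z hz hr).1)
  · have h := norm_exp_inversion hB (neg_mem_dom (hz.trans_lt hy : z ∈ dom B))
    rw [neg_neg] at h
    have hp := Real.exp_pos (-(2 * π * (-z).re * (-z).im))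
    have h2 := norm_exp_le_of_norm_le (hC (-z) (by simpa using hz) (by simpa using hr)).1
    rw [h, ← le_div_iff₀ hp] at h2
    refine h2.trans (le_of_eq ?_)
    rw [div_eq_mul_inv, ← Real.exp_neg]; congr 2; simp

lemma drPhi_bounds (hB : 0 < B) {y : ℝ} (hy : y < hw B) : ∃ C, 0 ≤ C ∧ ∀ z : ℂ, |z.im| ≤ y →
    (z.re ≤ 0 → ‖drPhi B z‖ ≤ C * Real.exp (2 * height B * z.re)) ∧
    (0 ≤ z.re → ‖drPhi B z‖ ≤ C * (1 + z.re) * Real.exp (2 * π * z.re * z.im)) := by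
  obtain ⟨C, hC0, hC⟩ := logPhi_bounds_left hB hy
  obtain ⟨D, hD0, hD⟩ := rPhi_bounds hB hy
  rcases lt_or_ge y 0 with hy0 | hy0
  · exact ⟨0, le_rfl, fun z hz => absurd (abs_nonneg z.im) (by linarith)⟩
  have hπ := Real.pi_pos
  refine ⟨(C + 2 * π * (1 + y)) * D, by positivity, fun z hz => ⟨fun hr => ?_, fun hr => ?_⟩⟩
  · rw [drPhi, norm_mul, norm_neg]
    have h0 : 0 ≤ 2 * π * (1 + y) * D * Real.exp (2 * height B * z.re) := by positivity
    calc _ ≤ (C * Real.exp (2 * height B * z.re)) * D :=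
          mul_le_mul (hC z hz hr).2 ((hD z hz).1 hr) (norm_nonneg _) (by positivity)
      _ ≤ _ := by linarith
  · rw [drPhi, norm_mul, norm_neg]
    have h1 := dlogPhi_sub_dlogPhi_neg hB (hz.trans_lt hy : z ∈ dom B)
    have h2 : ‖dlogPhi B (-z)‖ ≤ C := by
      refine ((hC (-z) (by simpa using hz) (by simpa using hr)).2).trans ?_
      refine mul_le_of_le_one_right hC0 (Real.exp_le_one_iff.2 ?_)
      have := height_pos hB
      simp only [Complex.neg_re]; nlinarith
    have h3 : ‖dlogPhi B z‖ ≤ 2 * π * ‖z‖ + C := by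
      have : dlogPhi B z = 2 * π * Complex.I * z + dlogPhi B (-z) := by linear_combination h1
      rw [this]
      refine (norm_add_le _ _).trans (add_le_add (le_of_eq ?_) h2)
      simp [abs_of_pos hπ]
    have h4 : ‖z‖ ≤ z.re + y := by
      refine (Complex.norm_le_abs_re_add_abs_im z).trans ?_
      rw [abs_of_nonneg hr]; linarith
    have h5 : ‖dlogPhi B z‖ ≤ (C + 2 * π * (1 + y)) * (1 + z.re) := by
      refine h3.trans ?_
      have : 0 ≤ C * z.re + 2 * π * (1 + y * z.re) := by positivity
      nlinarith
    calc _ ≤ ((C + 2 * π * (1 + y)) * (1 + z.re)) * (D * Real.exp (2 * π * z.re * z.im)) :=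
          mul_le_mul h5 ((hD z hz).2 hr) (norm_nonneg _) (by positivity)
      _ = _ := by ring

lemma expBound_of_sides {κ : ℝ → ℂ} {C α β : ℝ} (hC : 0 ≤ C) (hκ : Continuous κ) (hs : 0 ≤ α + β)
    (hr : ∀ t, 0 ≤ t → ‖κ t‖ ≤ C * Real.exp (-(α * t)))
    (hl : ∀ t, t ≤ 0 → ‖κ t‖ ≤ C * Real.exp (β * t)) : ExpBound κ C α β := by
  refine ⟨hκ, fun t => ?_, fun t => ?_⟩
  · rcases le_total 0 t with ht | ht
    · exact hr t ht
    · refine (hl t ht).trans (mul_le_mul_of_nonneg_left (Real.exp_le_exp.2 ?_) hC); nlinarith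
  · rcases le_total 0 t with ht | ht
    · refine (hr t ht).trans (mul_le_mul_of_nonneg_left (Real.exp_le_exp.2 ?_) hC); nlinarith
    · exact hl t ht

lemma line_mem_dom {u : ℝ} (hu : |u| < hw B) (t : ℝ) : (t : ℂ) + u * Complex.I ∈ dom B := by
  simpa [dom] using hu

lemma continuous_line {f : ℂ → ℂ} (hf : ContinuousOn f (dom B)) {u : ℝ} (hu : |u| < hw B) :
    Continuous fun t : ℝ => f (t + u * Complex.I) :=
  hf.comp_continuous (by fun_prop) (line_mem_dom hu)

lemma continuousOn_rPhi (hB : 0 < B) : ContinuousOn (rPhi B) (dom B) := fun _ hz =>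
  (hasDerivAt_rPhi hB hz).continuousAt.continuousWithinAt

lemma expBound_rPhi (hB : 0 < B) {u : ℝ} (hu : |u| < hw B) (hu0 : u ≤ 0) :
    ∃ C, ExpBound (fun t : ℝ => rPhi B (t + u * Complex.I)) C (-2 * π * u) 0 := by
  obtain ⟨C, hC0, hC⟩ := rPhi_bounds hB hu
  refine ⟨C, expBound_of_sides hC0 (continuous_line (continuousOn_rPhi hB) hu)
    (by nlinarith [Real.pi_pos]) (fun t ht => ?_) (fun t ht => ?_)⟩
  · refine ((hC (t + u * Complex.I) (by simp)).2 (by simpa using ht)).trans (le_of_eq ?_)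
    congr 2; simp; ring
  · simpa using (hC (t + u * Complex.I) (by simp)).1 (by simpa using ht)

lemma expBound_drPhi (hB : 0 < B) {y δ : ℝ} (hy : y < hw B) (hδ : 0 < δ) :
    ∃ C, ∀ u : ℝ, |u| ≤ y → δ ≤ 2 * height B - 2 * π * u →
      ExpBound (fun t : ℝ => drPhi B (t + u * Complex.I)) C (-2 * π * u - δ) (2 * height B) := by
  obtain ⟨C, hC0, hC⟩ := drPhi_bounds hB hy
  refine ⟨C * (1 + 1 / δ), fun u hu hd => expBound_of_sides (by positivity)
    (continuous_line (differentiableOn_drPhi hB).continuousOn (hu.trans_lt hy))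
    (by linarith) (fun t ht => ?_) (fun t ht => ?_)⟩
  · refine ((hC (t + u * Complex.I) (by simpa using hu)).2 (by simpa using ht)).trans ?_
    have e : Real.exp (-((-2 * π * u - δ) * t)) = Real.exp (2 * π * t * u) * Real.exp (δ * t) := by
      rw [← Real.exp_add]; congr 1; ring
    have h1 : 1 + t ≤ (1 + 1 / δ) * Real.exp (δ * t) := by
      have h2 := Real.add_one_le_exp (δ * t)
      have h3 : t = 1 / δ * (δ * t) := by field_simp
      have h4 : 1 / δ * (δ * t) ≤ 1 / δ * Real.exp (δ * t) :=
        mul_le_mul_of_nonneg_left (by linarith) (by positivity)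
      have h5 : 1 ≤ Real.exp (δ * t) := Real.one_le_exp (by positivity)
      linarith
    rw [e]
    simp only [Complex.add_re, Complex.ofReal_re, Complex.mul_re, Complex.I_re, mul_zero,
      Complex.ofReal_im, Complex.I_im, mul_one, sub_self, add_zero, Complex.add_im, Complex.mul_im,
      zero_add]
    calc _ ≤ C * ((1 + 1 / δ) * Real.exp (δ * t)) * Real.exp (2 * π * t * u) := by gcongr
      _ = _ := by ring
  · refine ((hC (t + u * Complex.I) (by simpa using hu)).1 (by simpa using ht)).trans ?_
    simp only [Complex.add_re, Complex.ofReal_re, Complex.mul_re, Complex.I_re, mul_zero,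
      Complex.ofReal_im, Complex.I_im, mul_one, sub_self, add_zero]
    have : 0 ≤ 1 / δ := by positivity
    gcongr
    nlinarith

end

section

variable {B : ℝ}

/-- The Fourier integral of `f` along the line `Im w = u`. -/
def lineInt (f : ℂ → ℂ) (u : ℝ) (s : ℂ) : ℂ :=
  ∫ t : ℝ, f (t + u * Complex.I) * Complex.exp (-2 * π * Complex.I * s * (t + u * Complex.I))

lemma lineKer_eq (f : ℂ → ℂ) (u : ℝ) (s : ℂ) (t : ℝ) :
    f (t + u * Complex.I) * Complex.exp (-2 * π * Complex.I * s * (t + u * Complex.I)) =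
      Complex.exp (2 * π * u * s) *
        (f (t + u * Complex.I) * Complex.exp (-2 * π * Complex.I * s * t)) := by
  have : Complex.exp (-2 * π * Complex.I * s * (t + u * Complex.I)) =
      Complex.exp (2 * π * u * s) * Complex.exp (-2 * π * Complex.I * s * t) := by
    rw [← Complex.exp_add]; congr 1; linear_combination (-2 * π * s * u) * Complex.I_sq
  rw [this]; ring

lemma lineInt_eq (f : ℂ → ℂ) (u : ℝ) (s : ℂ) :
    lineInt f u s = Complex.exp (2 * π * u * s) *
      ∫ t : ℝ, f (t + u * Complex.I) * Complex.exp (-2 * π * Complex.I * s * t) := by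
  unfold lineInt
  simp only [lineKer_eq]
  rw [integral_const_mul]

lemma re_fourier (s : ℂ) : (-2 * π * Complex.I * s).re = 2 * π * s.im := by simp

lemma norm_exp_fourier (u : ℝ) (s : ℂ) :
    ‖Complex.exp (2 * π * u * s)‖ = Real.exp (2 * π * u * s.re) := by
  rw [Complex.norm_exp]; congr 1; simp

section general

variable {f : ℂ → ℂ} {u C α β : ℝ} {s : ℂ}

lemma integrable_lineKer (h : ExpBound (fun t : ℝ => f (t + u * Complex.I)) C α β)
    (h1 : 2 * π * s.im < α) (h2 : -β < 2 * π * s.im) : Integrable fun t : ℝ =>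
      f (t + u * Complex.I) * Complex.exp (-2 * π * Complex.I * s * (t + u * Complex.I)) := by
  simp only [lineKer_eq]
  exact ((h.mul_exp _).integrable (by rw [re_fourier]; linarith)
    (by rw [re_fourier]; linarith)).const_mul _

lemma differentiableAt_lineInt (h : ExpBound (fun t : ℝ => f (t + u * Complex.I)) C α β)
    (h1 : 2 * π * s.im < α) (h2 : -β < 2 * π * s.im) : DifferentiableAt ℂ (lineInt f u) s := by
  have e : lineInt f u = fun s => Complex.exp (2 * π * u * s) *
      ∫ t : ℝ, f (t + u * Complex.I) * Complex.exp (-2 * π * Complex.I * s * t) :=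
    funext (lineInt_eq f u)
  have hd := (h.hasDerivAt_laplace (s := -2 * π * Complex.I * s) (by rw [re_fourier]; linarith)
    (by rw [re_fourier]; linarith)).differentiableAt
  have hd' : DifferentiableAt ℂ (fun s : ℂ => ∫ t : ℝ, f (t + u * Complex.I) *
      Complex.exp (-2 * π * Complex.I * s * t)) s :=
    hd.comp s (f := fun s : ℂ => -2 * π * Complex.I * s) (by fun_prop)
  rw [e]
  exact DifferentiableAt.mul (by fun_prop) hd'

lemma norm_lineInt_le (h : ExpBound (fun t : ℝ => f (t + u * Complex.I)) C α β)
    (h1 : 2 * π * s.im < α) (h2 : -β < 2 * π * s.im) :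
    ‖lineInt f u s‖ ≤ C * (1 / (α - 2 * π * s.im) + 1 / (β + 2 * π * s.im)) *
      Real.exp (2 * π * u * s.re) := by
  rw [lineInt_eq, norm_mul, norm_exp_fourier, mul_comm]
  refine mul_le_mul_of_nonneg_right ?_ (Real.exp_pos _).le
  have := (h.mul_exp (-2 * π * Complex.I * s)).norm_integral_le (by rw [re_fourier]; linarith)
    (by rw [re_fourier]; linarith)
  rwa [re_fourier] at this

lemma ExpBound.norm_le_exp_abs {κ : ℝ → ℂ} (h : ExpBound κ C α β) {γ : ℝ} (hα : γ ≤ α)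
    (hβ : γ ≤ β) (t : ℝ) : ‖κ t‖ ≤ C * Real.exp (-(γ * |t|)) := by
  rcases le_total 0 t with ht | ht
  · refine (h.right t).trans (mul_le_mul_of_nonneg_left (Real.exp_le_exp.2 ?_) h.nonneg)
    rw [abs_of_nonneg ht]; nlinarith
  · refine (h.left t).trans (mul_le_mul_of_nonneg_left (Real.exp_le_exp.2 ?_) h.nonneg)
    rw [abs_of_nonpos ht]; nlinarith

end general

lemma two_pi_mul_lt {a b : ℝ} (h : a < b) : 2 * π * a < 2 * π * b :=
  mul_lt_mul_of_pos_left h (by positivity)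

/-- The exponential bound for `drPhi` on a line, with the loss `δ` chosen for a given `s`. -/
lemma expBound_drPhi_line (hB : 0 < B) {u : ℝ} {s : ℂ} (hu : |u| < hw B) (h1 : s.im < -u)
    (h2 : -(2 * height B) < 2 * π * s.im) : ∃ C δ, 0 < δ ∧ 2 * π * s.im < -2 * π * u - δ ∧
      ExpBound (fun t : ℝ => drPhi B (t + u * Complex.I)) C (-2 * π * u - δ) (2 * height B) := by
  have h3 := two_pi_mul_lt h1
  obtain ⟨C, hC⟩ := expBound_drPhi hB hu (δ := (-2 * π * u - 2 * π * s.im) / 2) (by linarith)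
  exact ⟨C, _, by linarith, by linarith, hC u le_rfl (by linarith)⟩

lemma integrable_drPhi (hB : 0 < B) {u : ℝ} {s : ℂ} (hu : |u| < hw B) (h1 : s.im < -u)
    (h2 : -(2 * height B) < 2 * π * s.im) : Integrable fun t : ℝ =>
      drPhi B (t + u * Complex.I) *
        Complex.exp (-2 * π * Complex.I * s * (t + u * Complex.I)) := by
  obtain ⟨C, δ, -, h3, hC⟩ := expBound_drPhi_line hB hu h1 h2
  exact integrable_lineKer hC h3 h2

lemma differentiableAt_lineInt_drPhi (hB : 0 < B) {u : ℝ} {s : ℂ} (hu : |u| < hw B)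
    (h1 : s.im < -u) (h2 : -(2 * height B) < 2 * π * s.im) :
    DifferentiableAt ℂ (lineInt (drPhi B) u) s := by
  obtain ⟨C, δ, -, h3, hC⟩ := expBound_drPhi_line hB hu h1 h2
  exact differentiableAt_lineInt hC h3 h2

lemma lineInt_drPhi_shift (hB : 0 < B) {u₁ u₂ : ℝ} {s : ℂ} (hu : u₁ ≤ u₂) (hu₁ : |u₁| < hw B)
    (hu₂ : |u₂| < hw B) (h1 : s.im < -u₂) (h2 : -(2 * height B) < 2 * π * s.im) :
    lineInt (drPhi B) u₁ s = lineInt (drPhi B) u₂ s := by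
  have h1' : s.im < -u₁ := by linarith
  have i1 := integrable_drPhi hB hu₁ h1' h2
  have i2 := integrable_drPhi hB hu₂ h1 h2
  unfold lineInt
  rw [← sub_eq_zero, ← integral_sub i1 i2]
  have h3 := two_pi_mul_lt h1
  set δ := (-2 * π * u₂ - 2 * π * s.im) / 2 with hδ
  obtain ⟨C, hC⟩ := expBound_drPhi hB (max_lt hu₁ hu₂) (δ := δ) (by linarith)
  set γ := min δ (2 * height B + 2 * π * s.im) with hγ
  have hγ0 : 0 < γ := lt_min (by linarith) (by linarith)
  have hCu : ∀ u ∈ Icc u₁ u₂, |u| ≤ max |u₁| |u₂| ∧ 2 * π * u ≤ 2 * π * u₂ := fun u hu' =>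
    ⟨abs_le_max_abs_abs hu'.1 hu'.2, mul_le_mul_of_nonneg_left hu'.2 (by positivity)⟩
  refine integral_line_sub_eq_zero (X := 0) hu (f := fun w => drPhi B w *
    Complex.exp (-2 * π * Complex.I * s * w)) ?_
    (tendsto_exp_neg_mul_atTop hγ0 (Real.exp (2 * π * max |u₁| |u₂| * |s.re|) * C)) ?_ (i1.sub i2)
  · refine DifferentiableOn.mul ((differentiableOn_drPhi hB).mono fun w hw => ?_) (by fun_prop)
    exact (hCu w.im hw).1.trans_lt (max_lt hu₁ hu₂)
  · intro x y hy _
    obtain ⟨b1, b2⟩ := hCu y hy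
    have hE := (hC y b1 (by linarith)).mul_exp (-2 * π * Complex.I * s)
    simp only [re_fourier] at hE
    have := hE.norm_le_exp_abs (γ := γ) ((min_le_left _ _).trans (by linarith)) (min_le_right _ _) x
    rw [lineKer_eq, norm_mul, norm_exp_fourier,
      mul_assoc (Real.exp (2 * π * max |u₁| |u₂| * |s.re|)) C]
    refine mul_le_mul (Real.exp_le_exp.2 ?_) this (norm_nonneg _) (Real.exp_pos _).le
    calc 2 * π * y * s.re ≤ |2 * π * y * s.re| := le_abs_self _
      _ = 2 * π * |y| * |s.re| := by
        rw [abs_mul, abs_mul, abs_of_pos (by positivity : 0 < 2 * π)]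
      _ ≤ _ := by gcongr

lemma tendsto_of_expBound_atTop {κ : ℝ → ℂ} {C α β : ℝ} (h : ExpBound κ C α β) (hα : 0 < α) :
    Tendsto κ atTop (𝓝 0) :=
  squeeze_zero_norm h.right (tendsto_exp_neg_mul_atTop hα C)

lemma hasDerivAt_line {f : ℂ → ℂ} {f' : ℂ} {u t : ℝ} (h : HasDerivAt f f' (t + u * Complex.I)) :
    HasDerivAt (fun t : ℝ => f (t + u * Complex.I)) f' t :=
  (h.comp_add_const (t : ℂ) (u * Complex.I)).comp_ofReal

lemma lineInt_drPhi_zero (hB : 0 < B) {u : ℝ} (hu : |u| < hw B) (hu0 : u < 0) :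
    lineInt (drPhi B) u 0 = -1 := by
  have hi := integrable_drPhi hB hu (s := 0) (by simpa using hu0)
    (by simpa using height_pos hB)
  simp only [mul_zero, zero_mul, Complex.exp_zero, mul_one] at hi
  unfold lineInt
  simp only [mul_zero, zero_mul, Complex.exp_zero, mul_one]
  obtain ⟨C, hC⟩ := expBound_rPhi hB hu hu0.le
  have hT := tendsto_of_expBound_atTop hC (by nlinarith [Real.pi_pos])
  have hL : Tendsto (fun t : ℝ => rPhi B (t + u * Complex.I)) atBot (𝓝 1) := by
    have := (tendsto_logPhi_atBot hB (mem_dom_mul_I hu)).neg.cexp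
    simp only [neg_zero, Complex.exp_zero] at this
    refine this.congr fun t => ?_
    rw [rPhi, add_comm]
  rw [integral_of_hasDerivAt_of_tendsto
    (fun t => hasDerivAt_line (hasDerivAt_rPhi hB (line_mem_dom hu t))) hi hL hT]
  simp

lemma lineInt_drPhi_eq (hB : 0 < B) {u : ℝ} {s : ℂ} (hu : |u| < hw B) (h0 : 0 < s.im)
    (h1 : s.im < -u) : lineInt (drPhi B) u s = 2 * π * Complex.I * s * lineInt (rPhi B) u s := by
  have h3 := two_pi_mul_lt h1
  have h4 := two_pi_mul_lt h0
  have hi1 := integrable_drPhi hB hu h1 (by linarith [height_pos hB])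
  obtain ⟨C, hC⟩ := expBound_rPhi hB hu (by linarith)
  have hi2 := integrable_lineKer hC (s := s) (by linarith) (by linarith)
  have hE : ∀ t : ℝ, HasDerivAt (fun t : ℝ => rPhi B (t + u * Complex.I) *
      Complex.exp (-2 * π * Complex.I * s * (t + u * Complex.I)))
      (drPhi B (t + u * Complex.I) *
        Complex.exp (-2 * π * Complex.I * s * (t + u * Complex.I)) - 2 * π * Complex.I * s *
      (rPhi B (t + u * Complex.I) *
        Complex.exp (-2 * π * Complex.I * s * (t + u * Complex.I)))) t := by
    intro t
    have := ((hasDerivAt_id (t + u * Complex.I)).const_mul (-2 * π * Complex.I * s)).cexp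
    refine (hasDerivAt_line ((hasDerivAt_rPhi hB (line_mem_dom hu t)).mul this)).congr_deriv ?_
    simp only [id]; ring
  have := integral_eq_zero_of_hasDerivAt_of_integrable hE (hi1.sub (hi2.const_mul _)) hi2
  rw [integral_sub hi1 (hi2.const_mul _), integral_const_mul, sub_eq_zero] at this
  exact this

lemma rPhi_add_I_mul (hB : 0 < B) {w : ℂ} (hw : |w.im + B / 2| < (2 * B)⁻¹) :
    rPhi B (w + B * Complex.I) =
      rPhi B w * (1 + Complex.exp (Complex.I * π * B ^ 2) * Complex.exp (2 * π * B * w)) := by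
  have h := PhiS_sub_eq hB (z := w + B / 2 * Complex.I) (by simpa using hw)
  have e1 : w + B / 2 * Complex.I - Complex.I * B / 2 = w := by ring
  have e2 : w + B / 2 * Complex.I + Complex.I * B / 2 = w + B * Complex.I := by ring
  have e3 : Complex.exp (2 * π * B * (w + B / 2 * Complex.I)) =
      Complex.exp (Complex.I * π * B ^ 2) * Complex.exp (2 * π * B * w) := by
    rw [← Complex.exp_add]; congr 1; ring
  rw [e1, e2, e3] at h
  have n1 : PhiS B w ≠ 0 := by rw [PhiS_eq]; exact Complex.exp_ne_zero _
  have n2 : PhiS B (w + B * Complex.I) ≠ 0 := by rw [PhiS_eq]; exact Complex.exp_ne_zero _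
  rw [rPhi_eq, rPhi_eq, inv_mul_eq_div, eq_div_iff n1, inv_mul_eq_div, div_eq_iff n2]
  exact h

lemma drPhi_add_I_mul (hB : 0 < B) {w : ℂ} (hw : |w.im + B / 2| < (2 * B)⁻¹) :
    drPhi B (w + B * Complex.I) = drPhi B w +
      Complex.exp (Complex.I * π * B ^ 2) * (drPhi B w * Complex.exp (2 * π * B * w)) +
      2 * π * B * Complex.exp (Complex.I * π * B ^ 2) *
        (rPhi B w * Complex.exp (2 * π * B * w)) := by
  obtain ⟨d1, d2⟩ := im_mem_dom (z := w + B / 2 * Complex.I) (by simpa using hw)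
  rw [show w + B / 2 * Complex.I - Complex.I * B / 2 = w by ring] at d1
  rw [show w + B / 2 * Complex.I + Complex.I * B / 2 = w + B * Complex.I by ring] at d2
  have h1 := (hasDerivAt_rPhi hB d2).comp_add_const w (B * Complex.I)
  have h2 : HasDerivAt (fun w : ℂ => 2 * π * B * w) (2 * π * B) w := by
    simpa using (hasDerivAt_id w).const_mul (2 * π * B : ℂ)
  have h3 := (hasDerivAt_rPhi hB d1).mul
    ((h2.cexp.const_mul (Complex.exp (Complex.I * π * B ^ 2))).const_add 1)
  have hev : ∀ᶠ w' in 𝓝 w, |w'.im + B / 2| < (2 * B)⁻¹ :=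
    (isOpen_lt (by fun_prop) continuous_const).mem_nhds hw
  have h4 := h3.congr_of_eventuallyEq (f₁ := fun w => rPhi B (w + B * Complex.I)) (by
    filter_upwards [hev] with w' hw'
    exact rPhi_add_I_mul hB hw')
  rw [h1.unique h4]
  ring

/-- The difference equation of the Fourier integral of `drPhi`. -/
theorem lineInt_difference (hB : 0 < B) {u : ℝ} {s : ℂ} (hu1 : |u| < hw B)
    (hu2 : |u + B / 2| < (2 * B)⁻¹) (h1 : s.im < -(u + B))
    (h2 : -(2 * height B) < 2 * π * s.im) (h3 : -B < s.im) :
    Complex.exp (-2 * π * B * s) * lineInt (drPhi B) (u + B) s =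
      lineInt (drPhi B) u s + Complex.exp (Complex.I * π * B ^ 2) *
        (lineInt (drPhi B) u (s + B * Complex.I) +
          2 * π * B * lineInt (rPhi B) u (s + B * Complex.I)) := by
  have him : (s + B * Complex.I).im = s.im + B := by simp
  have p1 := two_pi_mul_lt h3
  have p2 := two_pi_mul_lt h1
  have hpB : 0 < 2 * π * B := by positivity
  have i1 := integrable_drPhi hB hu1 (s := s) (by linarith) h2
  have i2 := integrable_drPhi hB hu1 (s := s + B * Complex.I) (by rw [him]; linarith)
    (by rw [him]; linarith)
  obtain ⟨C, hC⟩ := expBound_rPhi hB hu1 (by linarith)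
  have i3 := integrable_lineKer hC (s := s + B * Complex.I) (by rw [him]; linarith)
    (by rw [him]; linarith)
  have i4 : Integrable fun t : ℝ => Complex.exp (Complex.I * π * B ^ 2) *
      (drPhi B (t + u * Complex.I) *
          Complex.exp (-2 * π * Complex.I * (s + B * Complex.I) * (t + u * Complex.I)) +
        2 * π * B * (rPhi B (t + u * Complex.I) *
          Complex.exp (-2 * π * Complex.I * (s + B * Complex.I) * (t + u * Complex.I)))) :=
    (i2.add (i3.const_mul _)).const_mul _
  unfold lineInt
  rw [← integral_const_mul, ← integral_const_mul, ← integral_add i2 (i3.const_mul _),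
    ← integral_const_mul, ← integral_add i1 i4]
  congr 1
  funext t
  have hl : (t : ℂ) + ((u + B : ℝ) : ℂ) * Complex.I = (t + u * Complex.I) + B * Complex.I := by
    push_cast; ring
  have hd := drPhi_add_I_mul hB (w := t + u * Complex.I) (by simpa using hu2)
  rw [hl, hd]
  set w : ℂ := t + u * Complex.I
  have e1 : Complex.exp (-2 * π * Complex.I * s * (w + B * Complex.I)) =
      Complex.exp (2 * π * B * s) * Complex.exp (-2 * π * Complex.I * s * w) := by
    rw [← Complex.exp_add]; congr 1; linear_combination (-2 * π * s * B) * Complex.I_sq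
  have e2 : Complex.exp (-2 * π * Complex.I * (s + B * Complex.I) * w) =
      Complex.exp (2 * π * B * w) * Complex.exp (-2 * π * Complex.I * s * w) := by
    rw [← Complex.exp_add]; congr 1; linear_combination (-2 * π * w * B) * Complex.I_sq
  have e3 : Complex.exp (-2 * π * B * s) * Complex.exp (2 * π * B * s) = 1 := by
    rw [← Complex.exp_add, ← Complex.exp_zero]; congr 1; ring
  rw [e1, e2]
  linear_combination (Complex.exp (-2 * π * Complex.I * s * w) * (drPhi B w +
      Complex.exp (Complex.I * π * B ^ 2) * (drPhi B w * Complex.exp (2 * π * B * w)) +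
      2 * π * B * Complex.exp (Complex.I * π * B ^ 2) *
        (rPhi B w * Complex.exp (2 * π * B * w)))) * e3

end

section

/-- A function holomorphic on `ℂ ∖ {0}` which is `o(1/q)` at `0` and `o(q)` at infinity is
constant. -/
lemma eq_of_sublinear {P : ℂ → ℂ} (hd : ∀ q ≠ 0, DifferentiableAt ℂ P q)
    (h0 : Tendsto (fun q => q * P q) (𝓝[≠] 0) (𝓝 0))
    (h1 : Tendsto (fun q => q⁻¹ * P q) (cocompact ℂ) (𝓝 0)) {q q' : ℂ} (hq : q ≠ 0)
    (hq' : q' ≠ 0) : P q = P q' := by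
  set G := Function.update P 0 (limUnder (𝓝[≠] 0) P) with hG
  have hGd : DifferentiableOn ℂ G univ := by
    refine Complex.differentiableOn_update_limUnder_of_isLittleO univ_mem
      (fun z hz => (hd z (by simpa using hz)).differentiableWithinAt) ?_
    refine (Asymptotics.isLittleO_iff_tendsto' ?_).2 ?_
    · filter_upwards [self_mem_nhdsWithin] with z hz h
      simp only [sub_zero, inv_eq_zero] at h
      exact absurd h hz
    · have h2 : Tendsto (fun z : ℂ => z * P 0) (𝓝[≠] 0) (𝓝 0) := by
        have : ContinuousAt (fun z : ℂ => z * P 0) 0 := by fun_prop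
        simpa using this.tendsto.mono_left nhdsWithin_le_nhds
      have h3 := h0.sub h2
      rw [sub_zero] at h3
      refine h3.congr fun z => ?_
      simp only [sub_zero, div_inv_eq_mul]; ring
  have hS : Differentiable ℂ (dslope G 0) := by
    rw [← differentiableOn_univ]
    exact (Complex.differentiableOn_dslope univ_mem).2 hGd
  have hne : ∀ᶠ z : ℂ in cocompact ℂ, z ≠ 0 :=
    (Set.finite_singleton (0 : ℂ)).isCompact.compl_mem_cocompact
  have hinv : Tendsto (fun z : ℂ => z⁻¹ * G 0) (cocompact ℂ) (𝓝 0) := by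
    rw [← Metric.cobounded_eq_cocompact]
    simpa using (tendsto_inv₀_cobounded (α := ℂ)).mul_const (G 0)
  have hT : Tendsto (dslope G 0) (cocompact ℂ) (𝓝 0) := by
    have h3 := h1.sub hinv
    rw [sub_zero] at h3
    refine h3.congr' ?_
    filter_upwards [hne] with z hz
    rw [dslope_of_ne _ hz, slope_def_field, hG, Function.update_of_ne hz]
    field_simp
    ring
  have key : ∀ z ≠ 0, P z = G 0 := fun z hz => by
    have h4 := hS.apply_eq_of_tendsto_cocompact z hT
    rw [dslope_of_ne _ hz, slope_def_field, div_eq_zero_iff, sub_zero, or_iff_left hz,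
      sub_eq_zero, hG, Function.update_of_ne hz] at h4
    exact h4
  rw [key q' hq', key q hq]

/-- The coordinate `q ↦ i(y + B/2) + (B/2π) log q` on the strip `y < Im ≤ y + B`. -/
def stripLog (B y : ℝ) (q : ℂ) : ℂ :=
  (y + B / 2 : ℝ) * Complex.I + (B / (2 * π) : ℝ) * Complex.log q

lemma stripLog_im (B y : ℝ) (q : ℂ) :
    (stripLog B y q).im = y + B / 2 + B / (2 * π) * q.arg := by
  rw [stripLog, Complex.add_im, Complex.im_ofReal_mul, Complex.im_ofReal_mul, Complex.log_im,
    Complex.I_im, mul_one]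

lemma stripLog_re (B y : ℝ) (q : ℂ) :
    (stripLog B y q).re = B / (2 * π) * Real.log ‖q‖ := by
  rw [stripLog, Complex.add_re, Complex.re_ofReal_mul, Complex.re_ofReal_mul, Complex.log_re,
    Complex.I_re, mul_zero, zero_add]

lemma mem_stripLog_im {B : ℝ} (hB : 0 < B) (y : ℝ) (q : ℂ) :
    y < (stripLog B y q).im ∧ (stripLog B y q).im ≤ y + B := by
  rw [stripLog_im]
  have h1 := mul_lt_mul_of_pos_left (Complex.neg_pi_lt_arg q) (show 0 < B / (2 * π) by positivity)
  have h2 := mul_le_mul_of_nonneg_left (Complex.arg_le_pi q) (show 0 ≤ B / (2 * π) by positivity)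
  have h3 : B / (2 * π) * π = B / 2 := by field_simp
  constructor <;> linarith

lemma log_neg_of_im_nonneg {q : ℂ} (h : 0 < q.im ∨ q.im = 0 ∧ q.re < 0) :
    Complex.log q = Complex.log (-q) + π * Complex.I := by
  have := Complex.arg_neg_eq_arg_sub_pi_iff.2 h
  rw [Complex.log, Complex.log, norm_neg, this]
  push_cast; ring

lemma log_neg_of_im_neg {q : ℂ} (h : q.im < 0) :
    Complex.log q = Complex.log (-q) - π * Complex.I := by
  have := Complex.arg_neg_eq_arg_add_pi_of_im_neg h
  rw [Complex.log, Complex.log, norm_neg, this]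
  push_cast; ring

section periodic

variable {R : ℂ → ℂ} {B y η : ℝ}

/-- A function on a strip that is periodic across it is holomorphic in the coordinate `q`. -/
lemma differentiableAt_comp_stripLog (hB : 0 < B) (hη : 0 < η)
    (hd : ∀ s : ℂ, y - η < s.im → s.im < y + B + η → DifferentiableAt ℂ R s)
    (hper : ∀ s : ℂ, |s.im - y| < η → R (s + B * Complex.I) = R s) {q : ℂ} (hq : q ≠ 0) :
    DifferentiableAt ℂ (fun q => R (stripLog B y q)) q := by
  by_cases hs : q ∈ Complex.slitPlane
  · obtain ⟨h1, h2⟩ := mem_stripLog_im hB y q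
    have hl : DifferentiableAt ℂ (stripLog B y) q :=
      ((Complex.differentiableAt_log hs).const_mul _).const_add _
    exact (hd _ (by linarith) (by linarith)).comp q hl
  · have hre : q.re < 0 := by
      rw [Complex.mem_slitPlane_iff_not_le_zero, not_not] at hs
      exact lt_of_le_of_ne hs.1 fun h => hq (Complex.ext h (by simpa using hs.2))
    have him : q.im = 0 := by
      rw [Complex.mem_slitPlane_iff_not_le_zero, not_not] at hs
      simpa using hs.2
    have hneg : -q ∈ Complex.slitPlane := Or.inl (by simpa using hre)
    set g : ℂ → ℂ := fun q => (y + B : ℝ) * Complex.I + (B / (2 * π) : ℝ) * Complex.log (-q)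
      with hg
    have hgd : DifferentiableAt ℂ g q :=
      (((Complex.differentiableAt_log hneg).comp q
        differentiable_neg.differentiableAt).const_mul _).const_add _
    have hgim : (g q).im = y + B := by
      have : (-q).arg = 0 := Complex.arg_eq_zero_iff.2 ⟨by simpa using hre.le, by simpa using him⟩
      rw [hg]
      simp only
      rw [Complex.add_im, Complex.im_ofReal_mul, Complex.im_ofReal_mul, Complex.log_im,
        Complex.I_im, this]
      ring
    have hcomp : DifferentiableAt ℂ (fun q => R (g q)) q :=
      (hd (g q) (by linarith) (by linarith)).comp q hgd
    refine hcomp.congr_of_eventuallyEq ?_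
    have e1 : ∀ᶠ q' in 𝓝 q, q'.re < 0 :=
      (Complex.continuous_re.isOpen_preimage _ isOpen_Iio).mem_nhds hre
    have e2 : ∀ᶠ q' in 𝓝 q, |(g q').im - (y + B)| < η := by
      have hc : ContinuousAt (fun q' => |(g q').im - (y + B)|) q :=
        ((Complex.continuous_im.continuousAt.comp hgd.continuousAt).sub continuousAt_const).abs
      exact hc.eventually_lt continuousAt_const (by simpa [hgim] using hη)
    filter_upwards [e1, e2] with q' h1 h2
    have hpi : (B / (2 * π) : ℝ) * (π * Complex.I) = (B / 2 : ℝ) * Complex.I := by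
      have : (π : ℂ) ≠ 0 := by exact_mod_cast Real.pi_ne_zero
      push_cast; field_simp
    by_cases h3 : q'.im < 0
    · have : stripLog B y q' = g q' - B * Complex.I := by
        rw [stripLog, log_neg_of_im_neg h3, hg, mul_sub, hpi]
        push_cast; ring
      have h4 := hper (stripLog B y q') (by
        rw [this]; simp only [Complex.sub_im, Complex.im_ofReal_mul, Complex.I_im]
        rwa [show (g q').im - B * 1 - y = (g q').im - (y + B) by ring])
      rw [← h4, this, sub_add_cancel]
    · have : stripLog B y q' = g q' := by
        rw [stripLog, log_neg_of_im_nonneg, hg, mul_add, hpi]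
        · push_cast; ring
        · rcases (not_lt.1 h3).lt_or_eq with h | h
          · exact Or.inl h
          · exact Or.inr ⟨h.symm, h1⟩
      rw [this]

/-- Liouville theorem for a periodic function of small exponential type on a strip. -/
theorem eq_of_periodic_strip {C α : ℝ} (hB : 0 < B) (hη : 0 < η)
    (hd : ∀ s : ℂ, y - η < s.im → s.im < y + B + η → DifferentiableAt ℂ R s)
    (hper : ∀ s : ℂ, |s.im - y| < η → R (s + B * Complex.I) = R s) (hα : α * B < 2 * π)
    (hbd : ∀ s : ℂ, 1 ≤ |s.re| → y ≤ s.im → s.im ≤ y + B → ‖R s‖ ≤ C * Real.exp (α * |s.re|))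
    {s s' : ℂ} (hs : y < s.im) (hs1 : s.im ≤ y + B) (hs' : y < s'.im) (hs1' : s'.im ≤ y + B) :
    R s = R s' := by
  have hpc : (π : ℂ) ≠ 0 := by exact_mod_cast Real.pi_ne_zero
  have hBc : (B : ℂ) ≠ 0 := by exact_mod_cast hB.ne'
  have hsurj : ∀ s : ℂ, y < s.im → s.im ≤ y + B → ∃ q ≠ 0, stripLog B y q = s := by
    intro s h1 h2
    refine ⟨Complex.exp ((2 * π / B : ℝ) * (s - (y + B / 2 : ℝ) * Complex.I)),
      Complex.exp_ne_zero _, ?_⟩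
    have him : ((2 * π / B : ℝ) * (s - (y + B / 2 : ℝ) * Complex.I)).im =
        2 * π / B * (s.im - y - B / 2) := by
      rw [Complex.im_ofReal_mul, Complex.sub_im, Complex.im_ofReal_mul, Complex.I_im]; ring
    have hk : 0 < 2 * π / B := by positivity
    have h3 : 2 * π / B * (B / 2) = π := by field_simp
    rw [stripLog, Complex.log_exp]
    · push_cast; field_simp; ring
    · rw [him]; nlinarith
    · rw [him]; nlinarith
  set κ := α * (B / (2 * π)) with hκ
  have hκ1 : κ < 1 := by
    rw [hκ, ← mul_div_assoc, div_lt_one (by positivity)]; exact hα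
  have hb2 : ∀ q : ℂ, 2 * π / B ≤ |Real.log ‖q‖| →
      ‖R (stripLog B y q)‖ ≤ C * Real.exp (κ * |Real.log ‖q‖|) := by
    intro q h
    have hre : |(stripLog B y q).re| = B / (2 * π) * |Real.log ‖q‖| := by
      rw [stripLog_re, abs_mul, abs_of_pos (by positivity)]
    obtain ⟨h1, h2⟩ := mem_stripLog_im hB y q
    have := hbd _ ?_ h1.le h2
    · rwa [hre, ← mul_assoc] at this
    · rw [hre]
      calc (1 : ℝ) = B / (2 * π) * (2 * π / B) := by field_simp
        _ ≤ _ := by gcongr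
  have hexp : ∀ q : ℂ, q ≠ 0 → ‖q‖ = Real.exp (Real.log ‖q‖) := fun q hq =>
    (Real.exp_log (norm_pos_iff.2 hq)).symm
  have hlog0 : Tendsto (fun q : ℂ => Real.log ‖q‖) (𝓝[≠] 0) atBot :=
    Real.tendsto_log_nhdsGT_zero.comp tendsto_norm_nhdsNE_zero
  have hlog1 : Tendsto (fun q : ℂ => Real.log ‖q‖) (cocompact ℂ) atTop :=
    Real.tendsto_log_atTop.comp (tendsto_norm_cocompact_atTop)
  have hne : ∀ᶠ z : ℂ in cocompact ℂ, z ≠ 0 :=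
    (Set.finite_singleton (0 : ℂ)).isCompact.compl_mem_cocompact
  have hlim := tendsto_exp_neg_mul_atTop (sub_pos.2 hκ1) C
  obtain ⟨q, hq, rfl⟩ := hsurj s hs hs1
  obtain ⟨q', hq', rfl⟩ := hsurj s' hs' hs1'
  refine eq_of_sublinear (P := fun q => R (stripLog B y q))
    (fun q hq => differentiableAt_comp_stripLog hB hη hd hper hq) ?_ ?_ hq hq'
  · refine squeeze_zero_norm' ?_ (hlim.comp (tendsto_neg_atBot_atTop.comp hlog0))
    filter_upwards [hlog0.eventually_le_atBot (-(2 * π / B)), self_mem_nhdsWithin] with q h1 h2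
    have hL : |Real.log ‖q‖| = -Real.log ‖q‖ := abs_of_nonpos
      (h1.trans (neg_nonpos.2 (by positivity)))
    have h3 := hb2 q (by rw [hL]; linarith)
    rw [norm_mul]
    calc ‖q‖ * _ ≤ ‖q‖ * (C * Real.exp (κ * |Real.log ‖q‖|)) := by gcongr
      _ = C * (Real.exp (Real.log ‖q‖) * Real.exp (κ * |Real.log ‖q‖|)) := by
        rw [← hexp q h2]; ring
      _ = _ := by
        rw [← Real.exp_add, hL]
        simp only [Function.comp_apply]
        ring_nf
  · refine squeeze_zero_norm' ?_ (hlim.comp hlog1)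
    filter_upwards [hlog1.eventually_ge_atTop (2 * π / B), hne] with q h1 h2
    have hL : |Real.log ‖q‖| = Real.log ‖q‖ := abs_of_nonneg
      (le_trans (by positivity) h1)
    have h3 := hb2 q (by rw [hL]; linarith)
    rw [norm_mul, norm_inv]
    calc ‖q‖⁻¹ * _ ≤ ‖q‖⁻¹ * (C * Real.exp (κ * |Real.log ‖q‖|)) := by gcongr
      _ = C * (Real.exp (-Real.log ‖q‖) * Real.exp (κ * |Real.log ‖q‖|)) := by
        rw [Real.exp_neg, ← hexp q h2]; ring
      _ = _ := by
        rw [← Real.exp_add, hL]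
        simp only [Function.comp_apply]
        ring_nf

end periodic

end

section

variable {B : ℝ}

/-- The entire function `(1 - e^{2πBs}) / (2πis)`. -/
def expQuot (B : ℝ) (s : ℂ) : ℂ :=
  dslope (fun s : ℂ => 1 - Complex.exp (2 * π * B * s)) 0 s / (2 * π * Complex.I)

lemma hasDerivAt_one_sub_exp (B : ℝ) (s : ℂ) :
    HasDerivAt (fun s : ℂ => 1 - Complex.exp (2 * π * B * s))
      (-(Complex.exp (2 * π * B * s) * (2 * π * B))) s := by
  have h2 : HasDerivAt (fun w : ℂ => 2 * π * B * w) (2 * π * B) s := by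
    simpa using (hasDerivAt_id s).const_mul (2 * π * B : ℂ)
  exact h2.cexp.const_sub 1

lemma differentiable_expQuot (B : ℝ) : Differentiable ℂ (expQuot B) := by
  refine Differentiable.div_const ?_ _
  rw [← differentiableOn_univ]
  exact (Complex.differentiableOn_dslope univ_mem).2 fun s _ =>
    (hasDerivAt_one_sub_exp B s).differentiableAt.differentiableWithinAt

lemma expQuot_zero (B : ℝ) : expQuot B 0 = Complex.I * B := by
  have hpc : (π : ℂ) ≠ 0 := by exact_mod_cast Real.pi_ne_zero
  rw [expQuot, dslope_same, (hasDerivAt_one_sub_exp B 0).deriv,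
    div_eq_iff Complex.two_pi_I_ne_zero, mul_zero, Complex.exp_zero]
  linear_combination (-2 * π * B) * Complex.I_sq

lemma expQuot_of_ne (B : ℝ) {s : ℂ} (hs : s ≠ 0) :
    expQuot B s = (1 - Complex.exp (2 * π * B * s)) / (2 * π * Complex.I * s) := by
  rw [expQuot, dslope_of_ne _ hs, slope_def_field, mul_zero, Complex.exp_zero, sub_self,
    sub_zero, sub_zero, div_div, mul_comm s]

lemma norm_expQuot_le (B : ℝ) {s : ℂ} (hs : 1 ≤ |s.re|) :
    ‖expQuot B s‖ ≤ 1 + Real.exp (2 * π * B * s.re) := by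
  have hs1 : 1 ≤ ‖s‖ := hs.trans (Complex.abs_re_le_norm s)
  have hs0 : s ≠ 0 := by rintro rfl; norm_num at hs1
  have hn : (1 : ℝ) ≤ ‖2 * π * Complex.I * s‖ := by
    rw [norm_mul, norm_mul, norm_mul, Complex.norm_I, Complex.norm_real, Real.norm_of_nonneg
      Real.pi_pos.le, Complex.norm_ofNat]
    nlinarith [Real.pi_gt_three]
  rw [expQuot_of_ne B hs0, norm_div]
  refine (div_le_self (norm_nonneg _) hn).trans ((norm_sub_le _ _).trans ?_)
  rw [norm_one, norm_exp_fourier]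

/-- A bound for the Fourier integral of `drPhi`, uniform on strips. -/
lemma norm_lineInt_drPhi_le (hB : 0 < B) {u y₁ y₂ : ℝ} (hu : |u| < hw B) (h1 : y₂ < -u)
    (h2 : -(2 * height B) < 2 * π * y₁) : ∃ K, 0 ≤ K ∧ ∀ s : ℂ, y₁ ≤ s.im → s.im ≤ y₂ →
      ‖lineInt (drPhi B) u s‖ ≤ K * Real.exp (2 * π * u * s.re) := by
  by_cases hy : y₁ ≤ y₂
  · obtain ⟨C, δ, -, h3, hC⟩ := expBound_drPhi_line hB (s := y₂ * Complex.I) hu (by simpa using h1)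
      (by
        have : 2 * π * y₁ ≤ 2 * π * y₂ := by gcongr
        simp; linarith)
    simp only [Complex.im_ofReal_mul, Complex.I_im, mul_one] at h3
    refine ⟨C * (1 / (-2 * π * u - δ - 2 * π * y₂) + 1 / (2 * height B + 2 * π * y₁)), ?_, ?_⟩
    · have e1 : 0 < -2 * π * u - δ - 2 * π * y₂ := by linarith
      have e2 : 0 < 2 * height B + 2 * π * y₁ := by linarith
      have := hC.nonneg
      positivity
    · intro s hs1 hs2
      have hs1' : 2 * π * y₁ ≤ 2 * π * s.im := by gcongr
      have hs2' : 2 * π * s.im ≤ 2 * π * y₂ := by gcongr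
      refine (norm_lineInt_le hC (by linarith) (by linarith)).trans ?_
      have := hC.nonneg
      have e1 : 0 < -2 * π * u - δ - 2 * π * y₂ := by linarith
      have e2 : 0 < 2 * height B + 2 * π * y₁ := by linarith
      gcongr
  · exact ⟨0, le_rfl, fun s hs1 hs2 => absurd (hs1.trans hs2) hy⟩

lemma two_mul_height (hB : 0 < B) (hB1 : B ≤ 1) : 2 * height B = π * B := by
  have : B ≤ B⁻¹ := hB1.trans ((one_le_inv₀ hB).2 hB1)
  rw [height, min_eq_left this]; ring

lemma cB_eq (B : ℝ) : cB B = hw B * Complex.I := by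
  rw [cB, hw]; push_cast; ring

/-- The periodic function whose constancy evaluates the Fourier transform. -/
def perFun (B : ℝ) (s : ℂ) : ℂ :=
  lineInt (drPhi B) (-(7 * B / 8)) s * expQuot B s * Complex.exp (-π * Complex.I * s ^ 2) *
    PhiS B (s - cB B + B * Complex.I)

lemma im_sub_cB (B : ℝ) (s : ℂ) (r : ℝ) : (s - cB B + r * Complex.I).im = s.im - hw B + r := by
  rw [cB_eq]; simp

lemma le_hw (hB : 0 < B) (hB1 : B ≤ 1) : B ≤ hw B ∧ hw B = B / 2 + (2 * B)⁻¹ ∧ B ≤ B⁻¹ ∧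
    B⁻¹ = 2 * (2 * B)⁻¹ := by
  have h1 : B ≤ B⁻¹ := hB1.trans ((one_le_inv₀ hB).2 hB1)
  have h2 : B⁻¹ = 2 * (2 * B)⁻¹ := by field_simp
  refine ⟨by rw [hw]; linarith, ?_, h1, h2⟩
  rw [hw]; linarith

lemma differentiableAt_perFun (hB : 0 < B) (hB1 : B ≤ 1) {s : ℂ} (h1 : -(B / 2) < s.im)
    (h2 : s.im < 7 * B / 8) : DifferentiableAt ℂ (perFun B) s := by
  obtain ⟨q1, q2, q3, q4⟩ := le_hw hB hB1
  have hu : |-(7 * B / 8)| < hw B := by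
    rw [abs_neg, abs_of_pos (by positivity)]; linarith
  have d1 := differentiableAt_lineInt_drPhi hB hu (s := s) (by linarith)
    (by rw [two_mul_height hB hB1]; nlinarith [Real.pi_pos])
  have d2 : DifferentiableAt ℂ (fun s => PhiS B (s - cB B + B * Complex.I)) s := by
    have : s - cB B + B * Complex.I ∈ dom B := by
      change |(s - cB B + B * Complex.I).im| < hw B
      rw [im_sub_cB, abs_lt]
      constructor <;> linarith
    exact (differentiableAt_PhiS hB this).comp s (f := fun s => s - cB B + B * Complex.I)
      (by fun_prop)
  exact ((d1.mul (differentiable_expQuot B s)).mul (by fun_prop)).mul d2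

/-- The functional equation of `PhiS` in shifted coordinates. -/
lemma PhiS_sub_cB (hB : 0 < B) {s : ℂ} {r : ℝ} (h1 : |s.im + r - (2 * B)⁻¹| < (2 * B)⁻¹) :
    PhiS B (s - cB B + r * Complex.I) =
      (1 - Complex.exp (2 * π * B * s) * Complex.exp (2 * π * B * r * Complex.I)) *
        PhiS B (s - cB B + r * Complex.I + B * Complex.I) := by
  have hBc : (B : ℂ) ≠ 0 := by exact_mod_cast hB.ne'
  have h := PhiS_sub_eq hB (z := s - cB B + (r + B / 2 : ℝ) * Complex.I) (by
    rw [im_sub_cB]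
    have : hw B = B / 2 + (2 * B)⁻¹ := by
      have h2 : B⁻¹ = 2 * (2 * B)⁻¹ := by field_simp
      rw [hw]; linarith
    rwa [show s.im - hw B + (r + B / 2) = s.im + r - (2 * B)⁻¹ by linarith])
  have e1 : s - cB B + (r + B / 2 : ℝ) * Complex.I - Complex.I * B / 2 =
      s - cB B + r * Complex.I := by push_cast; ring
  have e2 : s - cB B + (r + B / 2 : ℝ) * Complex.I + Complex.I * B / 2 =
      s - cB B + r * Complex.I + B * Complex.I := by push_cast; ring
  have e3 : Complex.exp (2 * π * B * (s - cB B + (r + B / 2 : ℝ) * Complex.I)) =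
      -(Complex.exp (2 * π * B * s) * Complex.exp (2 * π * B * r * Complex.I)) := by
    have : 2 * π * B * (s - cB B + (r + B / 2 : ℝ) * Complex.I) =
        2 * π * B * s + 2 * π * B * r * Complex.I - π * Complex.I := by
      rw [cB]; push_cast; field_simp; ring
    rw [this, Complex.exp_sub, Complex.exp_add, Complex.exp_pi_mul_I]; ring
  rw [e1, e2, e3] at h
  rw [h]; ring

lemma perFun_add (hB : 0 < B) (hB1 : B ≤ 1) {s : ℂ} (hs : |s.im - -(B / 4)| < B / 16) :
    perFun B (s + B * Complex.I) = perFun B s := by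
  obtain ⟨q1, q2, q3, q4⟩ := le_hw hB hB1
  obtain ⟨s1, s2⟩ := abs_lt.1 hs
  have him : (s + B * Complex.I).im = s.im + B := by simp
  have hs0 : s ≠ 0 := by rintro rfl; simp at s2; linarith
  have hs1 : s + B * Complex.I ≠ 0 := by
    intro h; rw [h] at him; simp at him; linarith
  have hu : |-(7 * B / 8)| < hw B := by
    rw [abs_neg, abs_of_pos (by positivity)]; linarith
  have hu' : |-(7 * B / 8) + B| < hw B := by
    rw [abs_lt]; constructor <;> linarith
  have hH : -(2 * height B) < 2 * π * s.im := by
    rw [two_mul_height hB hB1]; nlinarith [Real.pi_pos]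
  have hdiff := lineInt_difference hB (u := -(7 * B / 8)) (s := s) hu
    (by rw [abs_lt]; constructor <;> linarith) (by linarith) hH (by linarith)
  rw [← lineInt_drPhi_shift hB (u₁ := -(7 * B / 8)) (by linarith) hu hu' (by linarith) hH] at hdiff
  have hF := lineInt_drPhi_eq hB (s := s + B * Complex.I) hu (by linarith) (by linarith)
  have hPhi := PhiS_sub_cB hB (s := s) (r := B) (by rw [abs_lt]; constructor <;> linarith)
  have hsh : s + B * Complex.I - cB B + B * Complex.I =
      s - cB B + B * Complex.I + B * Complex.I := by ring
  have hg : Complex.exp (-π * Complex.I * (s + B * Complex.I) ^ 2) =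
      Complex.exp (-π * Complex.I * s ^ 2) * Complex.exp (2 * π * B * s) *
        Complex.exp (Complex.I * π * B ^ 2) := by
    rw [← Complex.exp_add, ← Complex.exp_add]; congr 1
    linear_combination (-2 * π * B * s - π * B ^ 2 * Complex.I) * Complex.I_sq
  have he : Complex.exp (2 * π * B * (s + B * Complex.I)) =
      Complex.exp (2 * π * B * s) * Complex.exp (2 * π * B * B * Complex.I) := by
    rw [← Complex.exp_add]; congr 1; ring
  have hinv : Complex.exp (-2 * π * B * s) * Complex.exp (2 * π * B * s) = 1 := by
    rw [← Complex.exp_add, ← Complex.exp_zero]; congr 1; ring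
  rw [perFun, perFun, expQuot_of_ne B hs0, expQuot_of_ne B hs1, hsh, hg, he, hPhi]
  set H0 := lineInt (drPhi B) (-(7 * B / 8)) s
  set H1 := lineInt (drPhi B) (-(7 * B / 8)) (s + B * Complex.I)
  set F1 := lineInt (rPhi B) (-(7 * B / 8)) (s + B * Complex.I)
  set P := PhiS B (s - cB B + B * Complex.I + B * Complex.I)
  set X := Complex.exp (2 * π * B * s)
  set X' := Complex.exp (-2 * π * B * s)
  set T := Complex.exp (Complex.I * π * B ^ 2)
  set M := Complex.exp (2 * π * B * B * Complex.I)
  set G := Complex.exp (-π * Complex.I * s ^ 2)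
  have key : (X' - 1) * H0 * (s + B * Complex.I) = T * s * H1 := by
    linear_combination (s + B * Complex.I) * hdiff + T * Complex.I * B * hF +
      (T * 2 * π * B * (s + B * Complex.I) * F1) * Complex.I_sq
  have hpc : (π : ℂ) ≠ 0 := by exact_mod_cast Real.pi_ne_zero
  have key2 : (1 - X) * H0 * (s + B * Complex.I) = X * T * s * H1 := by
    linear_combination X * key - H0 * (s + B * Complex.I) * hinv
  clear_value H1
  generalize s + B * Complex.I = s' at hs1 key2 ⊢
  field_simp
  linear_combination (-P * G * (1 - X * M)) * key2

lemma perFun_bound (hB : 0 < B) (hB1 : B ≤ 1) : ∃ C, ∀ s : ℂ, 1 ≤ |s.re| → -(B / 4) ≤ s.im →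
    s.im ≤ -(B / 4) + B → ‖perFun B s‖ ≤ C * Real.exp (3 * π / (2 * B) * |s.re|) := by
  obtain ⟨q1, q2, q3, q4⟩ := le_hw hB hB1
  have hpi := Real.pi_pos
  have hu : |-(7 * B / 8)| < hw B := by
    rw [abs_neg, abs_of_pos (by positivity)]; linarith
  have hu' : |-(B / 2)| < hw B := by
    rw [abs_neg, abs_of_pos (by positivity)]; linarith
  have hH : -(2 * height B) < 2 * π * (-(B / 4)) := by
    rw [two_mul_height hB hB1]; nlinarith
  obtain ⟨K₁, hK₁, b₁⟩ := norm_lineInt_drPhi_le hB (y₂ := 3 * B / 4) hu (by linarith) hH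
  obtain ⟨K₂, hK₂, b₂⟩ := norm_lineInt_drPhi_le hB (y₂ := B / 4) hu' (by linarith) hH
  obtain ⟨C, hC, bC⟩ := PhiS_bounds hB (y := hw B - B / 4) (by linarith)
  have hq : (3 * π / (2 * B)) = 3 * π * (2 * B)⁻¹ := by field_simp
  refine ⟨(K₁ + K₂) * 2 * C, fun s hs h1 h2 => ?_⟩
  have hE := norm_expQuot_le B hs
  have hG : ‖Complex.exp (-π * Complex.I * s ^ 2)‖ = Real.exp (2 * π * s.re * s.im) := by
    have := norm_exp_sq s (-1)
    simpa using this
  have hre : (s - cB B + B * Complex.I).re = s.re := by rw [cB_eq]; simp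
  obtain ⟨c1, c2⟩ := bC (s - cB B + B * Complex.I) (by
    rw [im_sub_cB, abs_le]; constructor <;> linarith)
  rw [hre, im_sub_cB] at c2
  rw [hre] at c1
  rw [perFun, norm_mul, norm_mul, norm_mul, hG]
  have combine : ∀ {p q r v e₁ e₂ e₃ E : ℝ}, 0 ≤ q → 0 ≤ r → 0 ≤ v →
      p ≤ (K₁ + K₂) * Real.exp e₁ → q ≤ 2 * Real.exp e₂ → r = Real.exp e₃ →
      v ≤ C * Real.exp (E - e₁ - e₂ - e₃) →
      E ≤ 3 * π / (2 * B) * |s.re| →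
      p * q * r * v ≤ (K₁ + K₂) * 2 * C * Real.exp (3 * π / (2 * B) * |s.re|) := by
    intro p q r v e₁ e₂ e₃ E hq hr hv h1 h2 h3 h4 h5
    subst h3
    calc p * q * Real.exp e₃ * v
        ≤ ((K₁ + K₂) * Real.exp e₁) * (2 * Real.exp e₂) * Real.exp e₃ *
          (C * Real.exp (E - e₁ - e₂ - e₃)) := by gcongr
      _ = (K₁ + K₂) * 2 * C * (Real.exp e₁ * Real.exp e₂ * Real.exp e₃ *
          Real.exp (E - e₁ - e₂ - e₃)) := by ring
      _ = (K₁ + K₂) * 2 * C * Real.exp E := by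
        rw [← Real.exp_add, ← Real.exp_add, ← Real.exp_add]; ring_nf
      _ ≤ _ := by gcongr
  rcases le_total 0 s.re with hx | hx
  · rw [abs_of_nonneg hx] at hs combine ⊢
    refine combine (e₁ := 2 * π * -(7 * B / 8) * s.re) (e₂ := 2 * π * B * s.re)
      (E := 2 * π * s.re * (hw B - 7 * B / 8)) (norm_nonneg _) (Real.exp_pos _).le (norm_nonneg _)
      ?_ ?_ rfl ?_ ?_
    · refine (b₁ s h1 (by linarith)).trans ?_
      gcongr
      linarith
    · have : 1 ≤ Real.exp (2 * π * B * s.re) := Real.one_le_exp (by positivity)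
      linarith
    · refine (c2 hx).trans (le_of_eq ?_)
      ring_nf
    · rw [hq, q2]
      have : 0 ≤ π * s.re := by positivity
      have hb : 0 ≤ (2 * B)⁻¹ := by positivity
      nlinarith [mul_nonneg this hb, mul_nonneg this hB.le]
  · have hE' : ‖expQuot B s‖ ≤ 2 * Real.exp 0 := by
      have : Real.exp (2 * π * B * s.re) ≤ 1 := Real.exp_le_one_iff.2
        (mul_nonpos_of_nonneg_of_nonpos (by positivity) hx)
      rw [Real.exp_zero]; linarith
    rw [abs_of_nonpos hx] at hs combine ⊢
    have fin : ∀ r : ℝ, r ≤ 3 * B / 4 → 2 * π * r * -s.re ≤ 3 * π / (2 * B) * -s.re := by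
      intro r hr
      have hx' : 0 ≤ -s.re := by linarith
      refine mul_le_mul_of_nonneg_right ?_ hx'
      rw [hq]; nlinarith
    rcases le_total (B / 4) s.im with hy | hy
    · refine combine (e₁ := 2 * π * -(7 * B / 8) * s.re)
        (E := 2 * π * (7 * B / 8 - s.im) * -s.re) (norm_nonneg _) (Real.exp_pos _).le
        (norm_nonneg _) ?_ hE' rfl ?_ (fin _ (by linarith))
      · refine (b₁ s h1 (by linarith)).trans ?_
        gcongr
        linarith
      · refine (c1 hx).trans (le_of_eq ?_)
        ring_nf
        simp
    · refine combine (e₁ := 2 * π * -(B / 2) * s.re)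
        (E := 2 * π * (B / 2 - s.im) * -s.re) (norm_nonneg _) (Real.exp_pos _).le
        (norm_nonneg _) ?_ hE' rfl ?_ (fin _ (by linarith))
      · rw [lineInt_drPhi_shift hB (u₂ := -(B / 2)) (by linarith) hu hu' (by linarith)
          (hH.trans_le (by gcongr))]
        refine (b₂ s h1 hy).trans ?_
        gcongr
        linarith
      · refine (c1 hx).trans (le_of_eq ?_)
        ring_nf
        simp

lemma perFun_zero (hB : 0 < B) (hB1 : B ≤ 1) :
    perFun B 0 = Complex.exp (-(Complex.I * π * (1 / 4 + (B ^ 2 + (B : ℂ)⁻¹ ^ 2) / 12))) := by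
  obtain ⟨q1, q2, q3, q4⟩ := le_hw hB hB1
  have hBc : (B : ℂ) ≠ 0 := by exact_mod_cast hB.ne'
  have hu : |-(7 * B / 8)| < hw B := by
    rw [abs_neg, abs_of_pos (by positivity)]; linarith
  have hz : 0 - cB B + B * Complex.I = -(((B⁻¹ - B) / 2 : ℝ) * Complex.I) := by
    rw [cB]; push_cast; ring
  have he : Complex.exp (-(Complex.I * π * (1 / 4 + (B ^ 2 + (B : ℂ)⁻¹ ^ 2) / 12))) =
      -Complex.I * Complex.exp (Complex.I * π * (1 / 4 - (B ^ 2 + (B : ℂ)⁻¹ ^ 2) / 12)) := by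
    rw [← Complex.exp_neg_pi_div_two_mul_I, ← Complex.exp_add]; congr 1; ring
  rw [perFun, lineInt_drPhi_zero hB hu (by linarith), expQuot_zero, hz, PhiS_special hB, he]
  simp only [ne_eq, OfNat.ofNat_ne_zero, not_false_eq_true, zero_pow, mul_zero, Complex.exp_zero]
  field_simp

lemma perFun_eq (hB : 0 < B) (hB1 : B ≤ 1) {s : ℂ} (h1 : -(B / 4) < s.im)
    (h2 : s.im ≤ -(B / 4) + B) : perFun B s =
      Complex.exp (-(Complex.I * π * (1 / 4 + (B ^ 2 + (B : ℂ)⁻¹ ^ 2) / 12))) := by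
  rw [← perFun_zero hB hB1]
  obtain ⟨C, hC⟩ := perFun_bound hB hB1
  refine eq_of_periodic_strip hB (η := B / 16) (by positivity)
    (fun s h1 h2 => differentiableAt_perFun hB hB1 (by linarith) (by linarith))
    (fun s hs => perFun_add hB hB1 hs) ?_ hC h1 h2 (by simpa using hB)
    (by simp; linarith)
  have : 3 * π / (2 * B) * B = 3 * π / 2 := by field_simp
  rw [this]; linarith [Real.pi_pos]

end

section

variable {B : ℝ}

lemma PhiS_ne_zero (B : ℝ) (z : ℂ) : PhiS B z ≠ 0 := by
  rw [PhiS_eq]; exact Complex.exp_ne_zero _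

lemma exp_neg_sq_mul (s : ℂ) :
    Complex.exp (π * Complex.I * s ^ 2) * Complex.exp (-π * Complex.I * s ^ 2) = 1 := by
  rw [← Complex.exp_add, ← Complex.exp_zero]; congr 1; ring

lemma lineInt_rPhi_of_im_small (hB : 0 < B) (hB1 : B ≤ 1) {u : ℝ} {s : ℂ} (hu : |u| < hw B)
    (h0 : 0 < s.im) (h1 : s.im < -u) (h2 : s.im ≤ 3 * B / 4) :
    lineInt (rPhi B) u s =
      Complex.exp (-(Complex.I * π * (1 / 4 + (B ^ 2 + (B : ℂ)⁻¹ ^ 2) / 12))) *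
        Complex.exp (π * Complex.I * s ^ 2) * (PhiS B (s - cB B))⁻¹ := by
  obtain ⟨q1, q2, q3, q4⟩ := le_hw hB hB1
  have hu' : |-(7 * B / 8)| < hw B := by
    rw [abs_neg, abs_of_pos (by positivity)]; linarith
  have hs0 : s ≠ 0 := by rintro rfl; simp at h0
  have hH : -(2 * height B) < 2 * π * s.im := by
    have := height_pos hB
    have : 0 < 2 * π * s.im := by positivity
    linarith
  have hsh : lineInt (drPhi B) (-(7 * B / 8)) s = lineInt (drPhi B) u s := by
    rcases le_total (-(7 * B / 8)) u with h | h
    · exact lineInt_drPhi_shift hB h hu' hu h1 hH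
    · exact (lineInt_drPhi_shift hB h hu hu' (by linarith) hH).symm
  have hR := perFun_eq hB hB1 (s := s) (by linarith) (by linarith)
  have hP := PhiS_sub_cB hB (s := s) (r := 0) (by rw [abs_lt]; constructor <;> linarith)
  simp only [Complex.ofReal_zero, zero_mul, mul_zero, Complex.exp_zero, mul_one, add_zero] at hP
  have hg := exp_neg_sq_mul s
  have hpc : (π : ℂ) ≠ 0 := by exact_mod_cast Real.pi_ne_zero
  rw [← hR, perFun, hsh, lineInt_drPhi_eq hB hu h0 h1, expQuot_of_ne B hs0, eq_mul_inv_iff_mul_eq₀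
    (PhiS_ne_zero B _), hP]
  generalize Complex.exp (-π * Complex.I * s ^ 2) = G' at hg ⊢
  generalize Complex.exp (π * Complex.I * s ^ 2) = G at hg ⊢
  field_simp
  linear_combination (-lineInt (rPhi B) u s * (1 - Complex.exp (2 * π * B * s)) *
    PhiS B (s - cB B + B * Complex.I)) * hg

lemma lineInt_rPhi_of_le_one (hB : 0 < B) (hB1 : B ≤ 1) {u : ℝ} {s : ℂ} (hu : |u| < hw B)
    (h0 : 0 < s.im) (h1 : s.im < -u) :
    lineInt (rPhi B) u s =
      Complex.exp (-(Complex.I * π * (1 / 4 + (B ^ 2 + (B : ℂ)⁻¹ ^ 2) / 12))) *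
        Complex.exp (π * Complex.I * s ^ 2) * (PhiS B (s - cB B))⁻¹ := by
  have hu0 : u < 0 := by linarith
  have hQ := abs_lt.1 hu
  set U : Set ℂ := {s | 0 < s.im ∧ s.im < -u} with hU
  have hUo : IsOpen U := (isOpen_lt continuous_const Complex.continuous_im).inter
    (isOpen_lt Complex.continuous_im continuous_const)
  have hUc : IsPreconnected U :=
    ((convex_halfSpace_im_gt 0).inter (convex_halfSpace_im_lt (-u))).isPreconnected
  obtain ⟨C, hC⟩ := expBound_rPhi hB hu hu0.le
  have hf : DifferentiableOn ℂ (lineInt (rPhi B) u) U := fun z hz => by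
    have p1 := two_pi_mul_lt hz.1
    have p2 := two_pi_mul_lt hz.2
    exact (differentiableAt_lineInt hC (by linarith) (by linarith)).differentiableWithinAt
  have hg : DifferentiableOn ℂ (fun s =>
      Complex.exp (-(Complex.I * π * (1 / 4 + (B ^ 2 + (B : ℂ)⁻¹ ^ 2) / 12))) *
        Complex.exp (π * Complex.I * s ^ 2) * (PhiS B (s - cB B))⁻¹) U := fun z hz => by
    have hz' : z - cB B ∈ dom B := by
      change |(z - cB B).im| < hw B
      have : (z - cB B).im = z.im - hw B := by rw [cB_eq]; simp
      rw [this, abs_lt]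
      constructor <;> linarith [hz.1, hz.2]
    have d := (differentiableAt_PhiS hB hz').comp z (f := fun s => s - cB B) (by fun_prop)
    exact (DifferentiableAt.mul (by fun_prop)
      (d.inv (PhiS_ne_zero B _))).differentiableWithinAt
  set m := min (-u) (3 * B / 4) with hm
  have hm0 : 0 < m := lt_min (by linarith) (by linarith)
  have hz₀ : ((m / 2 : ℝ) * Complex.I : ℂ) ∈ U := by
    simp only [hU, mem_ofPred_eq, Complex.im_ofReal_mul, Complex.I_im, mul_one]
    exact ⟨by linarith, by linarith [min_le_left (-u) (3 * B / 4)]⟩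
  refine (hf.analyticOnNhd hUo).eqOn_of_preconnected_of_eventuallyEq (hg.analyticOnNhd hUo) hUc
    hz₀ ?_ ⟨h0, h1⟩
  have hV : IsOpen {s : ℂ | s.im < m} := isOpen_lt Complex.continuous_im continuous_const
  filter_upwards [hUo.mem_nhds hz₀, hV.mem_nhds (by
    simp only [mem_ofPred_eq, Complex.im_ofReal_mul, Complex.I_im, mul_one]; linarith)] with z h1 h2
  exact lineInt_rPhi_of_im_small hB hB1 hu h1.1 h1.2
    ((le_of_lt h2).trans (min_le_right _ _))

/-- The Fourier transform of the inverse of the quantum dilogarithm. -/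
theorem lineInt_rPhi (hB : 0 < B) {u : ℝ} {s : ℂ} (hu : |u| < hw B)
    (h0 : 0 < s.im) (h1 : s.im < -u) :
    lineInt (rPhi B) u s =
      Complex.exp (-(Complex.I * π * (1 / 4 + (B ^ 2 + (B : ℂ)⁻¹ ^ 2) / 12))) *
        Complex.exp (π * Complex.I * s ^ 2) * (PhiS B (s - cB B))⁻¹ := by
  rcases le_total B 1 with hB1 | hB1
  · exact lineInt_rPhi_of_le_one hB hB1 hu h0 h1
  · have hr : rPhi B⁻¹ = rPhi B := funext fun z => by rw [rPhi_eq, rPhi_eq, PhiS_inv]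
    have hc : cB B⁻¹ = cB B := by rw [cB_eq, cB_eq, hw_inv]
    have := lineInt_rPhi_of_le_one (inv_pos.2 hB) (inv_le_one_of_one_le₀ hB1) (u := u) (s := s)
      (by rwa [hw_inv]) h0 h1
    rw [hr, hc, PhiS_inv] at this
    rw [this]
    push_cast
    rw [inv_inv, add_comm ((B : ℂ)⁻¹ ^ 2)]

lemma Phi_eq_PhiS {z : ℂ} (hz : z ∈ dom B) : Phi B z = PhiS B z := by
  obtain ⟨h1, h2⟩ := abs_lt.1 (show |z.im| < hw B from hz)
  rw [hw] at h1 h2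
  rw [Phi, if_neg (not_le.2 h1), if_neg (not_le.2 h2)]

lemma mem_dom_sub_cB {r : ℝ} (hB : 0 < B) (h0 : 0 < r) (h1 : r < 1 / 2) (x : ℝ) :
    (x : ℂ) - 2 * cB B * r ∈ dom B := by
  change |((x : ℂ) - 2 * cB B * r).im| < hw B
  have : ((x : ℂ) - 2 * cB B * r).im = -(2 * hw B * r) := by rw [cB_eq]; simp
  have hQ := hw_pos hB
  rw [this, abs_neg, abs_of_pos (by positivity)]
  nlinarith

end

end QuantumDilog

open QuantumDilog

/-- Equality (6) of the paper: `ψ̃′_{a,c}(x) = e^{-iπ/12} ψ_{c,b}(x)` with `b = 1/2 - a - c`. -/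
theorem psiT'_eq_psi (bb : ℝ) (hbb : 0 < bb) (a c : ℝ)
    (ha : 0 < a) (hc : 0 < c) (hb : 0 < 1 / 2 - a - c) (x : ℝ) :
    psiT' bb a c x = Complex.exp (-π * Complex.I / 12) * psiF bb c (1 / 2 - a - c) (x : ℂ) := by
  have hbc : (bb : ℂ) ≠ 0 := by exact_mod_cast hbb.ne'
  have hQ := hw_pos hbb
  have hcb := cB_eq bb
  set u : ℝ := -(2 * hw bb * (a + c)) with hu_def
  have hu : |u| < hw bb := by
    rw [hu_def, abs_neg, abs_of_pos (by positivity)]; nlinarith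
  set s : ℂ := x + 2 * cB bb * a with hs
  have hsim : s.im = 2 * hw bb * a := by rw [hs, hcb]; simp
  have hF := lineInt_rPhi hbb hu (s := s) (by rw [hsim]; positivity)
    (by rw [hsim, hu_def]; nlinarith [mul_pos hQ hc])
  have hker : ∀ t : ℝ, psiF bb a c t * Complex.exp (-2 * π * Complex.I * x * t) =
      Complex.exp (-4 * π * Complex.I * s * cB bb * (a + c) +
        4 * π * Complex.I * cB bb ^ 2 * a * (a + c) -
        π * Complex.I * (cB bb) ^ 2 * (4 * (a - c) + 1) / 6) *
      (rPhi bb (t + u * Complex.I) *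
        Complex.exp (-2 * π * Complex.I * s * (t + u * Complex.I))) := by
    intro t
    have ht : (t : ℂ) - 2 * cB bb * (a + c) = t + u * Complex.I := by
      rw [hcb, hu_def]; push_cast; ring
    have hd := mem_dom_sub_cB hbb (r := a + c) (by linarith) (by linarith) t
    push_cast at hd
    rw [psiF, Phi_eq_PhiS hd, ← ht, rPhi_eq, mul_left_comm (Complex.exp _), mul_assoc, mul_assoc,
      ← Complex.exp_add, ← Complex.exp_add, ← Complex.exp_add]
    congr 2
    rw [hs]
    ring
  have hT : psiT bb a c x = Complex.exp (-4 * π * Complex.I * s * cB bb * (a + c) +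
        4 * π * Complex.I * cB bb ^ 2 * a * (a + c) -
        π * Complex.I * (cB bb) ^ 2 * (4 * (a - c) + 1) / 6) * lineInt (rPhi bb) u s := by
    rw [psiT, lineInt, ← integral_const_mul]
    exact integral_congr_ae (Filter.Eventually.of_forall hker)
  have hd := mem_dom_sub_cB hbb (r := 1 / 2 - a) (by linarith) (by linarith) x
  have harg : (x : ℂ) - 2 * cB bb * (c + ((1 / 2 - a - c : ℝ) : ℂ)) =
      x - 2 * cB bb * ((1 / 2 - a : ℝ) : ℂ) := by push_cast; ring
  have hsc : s - cB bb = x - 2 * cB bb * ((1 / 2 - a : ℝ) : ℂ) := by rw [hs]; push_cast; ring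
  have hcsq : ((bb : ℂ) ^ 2 + (bb : ℂ)⁻¹ ^ 2) = -4 * cB bb ^ 2 - 2 := by
    rw [cB]; push_cast; field_simp
    linear_combination 4 * ((bb : ℂ) ^ 2 + 1) ^ 2 * Complex.I_sq
  rw [psiT', hT, hF, psiF, harg, Phi_eq_PhiS hd, hsc, hcsq]
  set P := (PhiS bb (x - 2 * cB bb * ((1 / 2 - a : ℝ) : ℂ)))⁻¹
  have assemble : ∀ e₁ e₂ e₃ e₄ f₁ f₂ f₃ : ℂ, e₁ + e₂ + e₃ + e₄ = f₁ + f₂ + f₃ →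
      Complex.exp e₁ * (Complex.exp e₂ * (Complex.exp e₃ * Complex.exp e₄ * P)) =
        Complex.exp f₁ * (P * Complex.exp f₂ * Complex.exp f₃) := by
    intro e₁ e₂ e₃ e₄ f₁ f₂ f₃ h
    calc _ = P * Complex.exp (e₁ + e₂ + e₃ + e₄) := by
          rw [Complex.exp_add, Complex.exp_add, Complex.exp_add]; ring
      _ = _ := by rw [h, Complex.exp_add, Complex.exp_add]; ring
  refine assemble _ _ _ _ _ _ _ ?_
  rw [hs]
  push_cast
  ring
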